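/- arXiv:math/0611850 — 2 statements merged into one kernel-verified Lean document; each statement's English description precedes it below -/
import Mathlib

section
/- Let n ≥ 1, let Q = 2n + 2, and let α ∈ ℝ satisfy Q + α − 2 > 0. Then the constant ((Q + α − 2)/2)² in the weighted Hardy inequality on ℍⁿ is sharp: for every real number C > ((Q + α − 2)/2)² there exists a real-valued φ ∈ C_c^∞(ℝ^{2n+1} \ {0}) with ∫_{ℝ^{2n+1}} ρ^{α−4} |z|² φ² dz dt > 0 such that ∫_{ℝ^{2n+1}} ρ^α |∇_ℍ φ|² dz dt < C ∫_{ℝ^{2n+1}} ρ^{α−4} |z|² φ² dz dt. -/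
open MeasureTheory Real

noncomputable section

/-- The underlying space of the Heisenberg group ℍⁿ, identified with ℝ^{2n+1}:
points `(x, y, t)` with `x y : Fin n → ℝ`, `t : ℝ`; write `z = (x, y)`. -/
abbrev Hspace (n : ℕ) : Type := (Fin n → ℝ) × (Fin n → ℝ) × ℝ

/-- The horizontal vector field `X_j f = ∂f/∂x_j + 2 y_j ∂f/∂t`. -/
def Xd (n : ℕ) (j : Fin n) (f : Hspace n → ℝ) (p : Hspace n) : ℝ :=
  fderiv ℝ f p (Pi.single j 1, 0, 0) + 2 * p.2.1 j * fderiv ℝ f p (0, 0, 1)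

/-- The horizontal vector field `Y_j f = ∂f/∂y_j − 2 x_j ∂f/∂t`. -/
def Yd (n : ℕ) (j : Fin n) (f : Hspace n → ℝ) (p : Hspace n) : ℝ :=
  fderiv ℝ f p (0, Pi.single j 1, 0) - 2 * p.1 j * fderiv ℝ f p (0, 0, 1)

/-- Squared length of the horizontal gradient: `|∇_ℍ f|² = Σ_j ((X_j f)² + (Y_j f)²)`. -/
def gradH2 (n : ℕ) (f : Hspace n → ℝ) (p : Hspace n) : ℝ :=
  ∑ j : Fin n, ((Xd n j f p) ^ 2 + (Yd n j f p) ^ 2)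

/-- The Kohn sub-Laplacian `Δ_ℍ f = Σ_j (X_j(X_j f) + Y_j(Y_j f))`. -/
def lapH (n : ℕ) (f : Hspace n → ℝ) (p : Hspace n) : ℝ :=
  ∑ j : Fin n, (Xd n j (Xd n j f) p + Yd n j (Yd n j f) p)

/-- `|z|² = |x|² + |y|²`. -/
def zSq (n : ℕ) (p : Hspace n) : ℝ := ∑ j : Fin n, ((p.1 j) ^ 2 + (p.2.1 j) ^ 2)

/-- The homogeneous norm `ρ(z, t) = (|z|⁴ + t²)^{1/4}`. -/
def rho (n : ℕ) (p : Hspace n) : ℝ := ((zSq n p) ^ 2 + p.2.2 ^ 2) ^ ((4 : ℝ)⁻¹)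


def NN (n : ℕ) (p : Hspace n) : ℝ := (zSq n p) ^ 2 + p.2.2 ^ 2

lemma zSq_nonneg (n : ℕ) (p : Hspace n) : 0 ≤ zSq n p :=
  Finset.sum_nonneg fun j _ => by positivity

lemma NN_nonneg (n : ℕ) (p : Hspace n) : 0 ≤ NN n p := by unfold NN; positivity

lemma zSq_of_NN (n : ℕ) (p : Hspace n) (h : NN n p = 0) : zSq n p = 0 := by
  unfold NN at h
  have := sq_nonneg (zSq n p)
  have := sq_nonneg p.2.2
  have : zSq n p ^ 2 = 0 := by linarith
  simpa using this

lemma zSq_contDiff (n : ℕ) : ContDiff ℝ (⊤ : ℕ∞) (zSq n) := by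
  unfold zSq; fun_prop

lemma NN_contDiff (n : ℕ) : ContDiff ℝ (⊤ : ℕ∞) (NN n) := by
  unfold NN; have := zSq_contDiff n; fun_prop

lemma rho_rpow (n : ℕ) (p : Hspace n) (a : ℝ) : rho n p ^ a = NN n p ^ (a / 4) := by
  change (NN n p ^ (4:ℝ)⁻¹) ^ a = _
  rw [← Real.rpow_mul (NN_nonneg n p)]
  congr 1; ring

lemma zSq_hasFDerivAt (n : ℕ) (p v : Hspace n) :
    fderiv ℝ (zSq n) p v = ∑ j, (2 * p.1 j * v.1 j + 2 * p.2.1 j * v.2.1 j) := by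
  have h : HasLineDerivAt ℝ (zSq n) (∑ j, (2 * p.1 j * v.1 j + 2 * p.2.1 j * v.2.1 j)) p v := by
    unfold HasLineDerivAt zSq
    apply HasDerivAt.fun_sum
    intro j _
    have h1 : HasDerivAt (fun t : ℝ => p.1 j + t * v.1 j) (v.1 j) 0 := by
      simpa using ((hasDerivAt_id (0:ℝ)).mul_const (v.1 j)).const_add (p.1 j)
    have h2 : HasDerivAt (fun t : ℝ => p.2.1 j + t * v.2.1 j) (v.2.1 j) 0 := by
      simpa using ((hasDerivAt_id (0:ℝ)).mul_const (v.2.1 j)).const_add (p.2.1 j)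
    have := (h1.pow 2).add (h2.pow 2)
    refine (this.congr_deriv ?_)
    simp
  have hd : DifferentiableAt ℝ (zSq n) p := (zSq_contDiff n).differentiable (by simp) p
  exact (hd.hasFDerivAt.hasLineDerivAt v).unique h

lemma NN_fderiv (n : ℕ) (p v : Hspace n) :
    fderiv ℝ (NN n) p v = 2 * zSq n p * fderiv ℝ (zSq n) p v + 2 * p.2.2 * v.2.2 := by
  have hd : DifferentiableAt ℝ (zSq n) p := (zSq_contDiff n).differentiable (by simp) p
  have h2 : HasFDerivAt (fun p : Hspace n => p.2.2)
      ((ContinuousLinearMap.snd ℝ _ _).comp (ContinuousLinearMap.snd ℝ _ _)) p :=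
    ((ContinuousLinearMap.snd ℝ (Fin n → ℝ) ℝ).comp
      (ContinuousLinearMap.snd ℝ (Fin n → ℝ) ((Fin n → ℝ) × ℝ))).hasFDerivAt
  have h := (hd.hasFDerivAt.pow 2).add (h2.pow 2)
  have h' : HasFDerivAt (NN n) _ p := h
  rw [h'.fderiv]
  simp

lemma grad_comp (n : ℕ) (p : Hspace n) (φ : Hspace n → ℝ) (c : ℝ)
    (h : ∀ v, fderiv ℝ φ p v = c * fderiv ℝ (NN n) p v) :
    gradH2 n φ p = c ^ 2 * (16 * NN n p * zSq n p) := by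
  have key : ∀ j, Xd n j φ p ^ 2 + Yd n j φ p ^ 2 =
      c ^ 2 * (16 * NN n p) * (p.1 j ^ 2 + p.2.1 j ^ 2) := by
    intro j
    simp only [Xd, Yd, h, NN_fderiv, zSq_hasFDerivAt]
    simp [Pi.single_apply]
    unfold NN
    ring
  unfold gradH2
  simp_rw [key]
  rw [← Finset.mul_sum]
  unfold zSq
  ring

def dil (n : ℕ) (l : ℝ) : Hspace n →ₗ[ℝ] Hspace n :=
  LinearMap.prodMap (l • LinearMap.id) (LinearMap.prodMap (l • LinearMap.id) ((l^2) • LinearMap.id))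

lemma dil_det (n : ℕ) (l : ℝ) : LinearMap.det (dil n l) = l ^ (2 * n + 2) := by
  unfold dil
  rw [LinearMap.det_prodMap, LinearMap.det_prodMap]
  simp [LinearMap.det_smul]
  ring

lemma zSq_dil (n : ℕ) (l : ℝ) (p : Hspace n) : zSq n (dil n l p) = l ^ 2 * zSq n p := by
  simp [zSq, dil, Finset.mul_sum]
  congr 1; ext j; ring

lemma NN_dil (n : ℕ) (l : ℝ) (p : Hspace n) : NN n (dil n l p) = l ^ 4 * NN n p := by
  simp [NN, zSq_dil]
  simp [dil]; ring

lemma lintegral_dil (n : ℕ) (l : ℝ) (hl : 0 < l) (f : Hspace n → ENNReal) (hf : Measurable f) :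
    ∫⁻ p, f (dil n l p) = ENNReal.ofReal ((l ^ (2 * n + 2))⁻¹) * ∫⁻ p, f p := by
  have hm : Measurable (dil n l) := (LinearMap.continuous_of_finiteDimensional _).measurable
  have i1 : (volume : Measure ((Fin n → ℝ) × ℝ)).IsAddHaarMeasure :=
    Measure.prod.instIsAddHaarMeasure _ _
  have i2 : (volume : Measure (Hspace n)).IsAddHaarMeasure :=
    Measure.prod.instIsAddHaarMeasure _ _
  have h0 : LinearMap.det (dil n l) ≠ 0 := by rw [dil_det]; positivity
  rw [← lintegral_map hf hm, Measure.map_linearMap_addHaar_eq_smul_addHaar volume h0, dil_det,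
    lintegral_smul_measure, abs_of_pos (by positivity)]
  rfl

def wt (n : ℕ) (p : Hspace n) : ℝ := zSq n p * NN n p ^ (-((n:ℝ) + 2) / 2)

def LL (n : ℕ) (p : Hspace n) : ℝ := Real.log (NN n p) / 4

lemma NN_meas (n : ℕ) : Measurable (NN n) := (NN_contDiff n).continuous.measurable
lemma LL_meas (n : ℕ) : Measurable (LL n) := by
  unfold LL; have := NN_meas n; fun_prop
lemma wt_meas (n : ℕ) : Measurable (wt n) := by
  unfold wt; have := NN_meas n
  have := (zSq_contDiff n).continuous.measurable
  fun_prop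

lemma wt_dil (n : ℕ) (l : ℝ) (hl : 0 < l) (p : Hspace n) :
    wt n (dil n l p) = (l ^ (2 * n + 2))⁻¹ * wt n p := by
  unfold wt
  rw [zSq_dil, NN_dil, Real.mul_rpow (by positivity) (NN_nonneg n p)]
  have : (l ^ 4) ^ (-((n:ℝ) + 2) / 2) = (l ^ (2 * n + 2))⁻¹ * (l ^ 2)⁻¹ := by
    rw [← Real.rpow_natCast, ← Real.rpow_natCast, ← Real.rpow_natCast, ← Real.rpow_mul hl.le,
      ← Real.rpow_neg hl.le, ← Real.rpow_neg hl.le, ← Real.rpow_add hl]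
    congr 1; push_cast; ring
  rw [this]
  field_simp

lemma LL_dil (n : ℕ) (a : ℝ) (p : Hspace n) (hp : NN n p ≠ 0) :
    LL n (dil n (Real.exp a) p) = a + LL n p := by
  unfold LL
  rw [NN_dil, Real.log_mul (by positivity) hp, Real.log_pow, Real.log_exp]
  push_cast; ring

def mu (n : ℕ) : Measure (Hspace n) := volume.withDensity (fun p => ENNReal.ofReal (wt n p))
def pim (n : ℕ) : Measure ℝ := (mu n).map (LL n)

lemma lintegral_pim (n : ℕ) (F : ℝ → ENNReal) (hF : Measurable F) :
    ∫⁻ s, F s ∂(pim n) = ∫⁻ p, ENNReal.ofReal (wt n p) * F (LL n p) := by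
  unfold pim mu
  rw [lintegral_map hF (LL_meas n)]
  exact lintegral_withDensity_eq_lintegral_mul _
    (wt_meas n).ennreal_ofReal (hF.comp (LL_meas n))

lemma wt_of_NN (n : ℕ) (p : Hspace n) (h : NN n p = 0) : wt n p = 0 := by
  unfold wt; rw [zSq_of_NN n p h, zero_mul]

instance pim_inv (n : ℕ) : (pim n).IsAddLeftInvariant := by
  constructor
  intro a
  refine Measure.ext_of_lintegral _ fun F hF => ?_
  rw [lintegral_map hF (by fun_prop), lintegral_pim n _ (by fun_prop), lintegral_pim n F hF]
  set l := Real.exp a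
  have hl : 0 < l := Real.exp_pos a
  have hh : ENNReal.ofReal ((l ^ (2 * n + 2))⁻¹) ≠ 0 := by
    simp; positivity
  have h := lintegral_dil n l hl (fun p => ENNReal.ofReal (wt n p) * F (LL n p))
    ((wt_meas n).ennreal_ofReal.mul (hF.comp (LL_meas n)))
  rw [← ENNReal.mul_right_inj hh ENNReal.ofReal_ne_top, ← h, ← lintegral_const_mul' _ _ ENNReal.ofReal_ne_top]
  congr 1; ext p
  by_cases hp : NN n p = 0
  · simp [wt_dil n l hl, wt_of_NN n p hp]
  · rw [wt_dil n l hl, LL_dil n a p hp, ENNReal.ofReal_mul (by positivity), mul_assoc]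

lemma NN_le_isCompact (n : ℕ) (M : ℝ) : IsCompact {p : Hspace n | NN n p ≤ M} := by
  apply Metric.isCompact_of_isClosed_isBounded
  · exact isClosed_le (NN_contDiff n).continuous continuous_const
  · rw [isBounded_iff_forall_norm_le]
    refine ⟨1 + M, fun p hp => ?_⟩
    have hp : zSq n p ^ 2 + p.2.2 ^ 2 ≤ M := hp
    have h1 : ∀ j, (p.1 j)^2 + (p.2.1 j)^2 ≤ zSq n p := fun j =>
      Finset.single_le_sum (f := fun j => (p.1 j)^2 + (p.2.1 j)^2)
        (fun _ _ => by positivity) (Finset.mem_univ j)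
    have hz := zSq_nonneg n p
    have hM : 0 ≤ M := le_trans (by positivity) hp
    have hzM : zSq n p ≤ 1 + M := by nlinarith [sq_nonneg p.2.2, sq_nonneg (zSq n p - 1)]
    have e : ∀ x : ℝ, x ^ 2 ≤ zSq n p → |x| ≤ 1 + M := by
      intro x hx
      have : |x|^2 = x^2 := sq_abs x
      nlinarith [sq_nonneg (|x| - 1), sq_nonneg p.2.2, sq_nonneg (zSq n p - 1), abs_nonneg x]
    refine max_le ?_ (max_le ?_ ?_)
    · refine (pi_norm_le_iff_of_nonneg (by positivity)).2 fun j => e _ ?_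
      nlinarith [h1 j, sq_nonneg (p.2.1 j)]
    · refine (pi_norm_le_iff_of_nonneg (by positivity)).2 fun j => e _ ?_
      nlinarith [h1 j, sq_nonneg (p.1 j)]
    · rw [Real.norm_eq_abs]
      have : |p.2.2|^2 = p.2.2^2 := sq_abs _
      nlinarith [sq_nonneg (|p.2.2| - 1), abs_nonneg p.2.2, sq_nonneg (zSq n p)]

instance pim_fin (n : ℕ) : IsFiniteMeasureOnCompacts (pim n) := by
  constructor
  intro K hK
  obtain ⟨M, hM⟩ := hK.isBounded.exists_norm_le
  have h1 : pim n K ≤ pim n (Set.Icc (-M) M) := measure_mono fun x hx => by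
    have := hM x hx
    rw [Real.norm_eq_abs, abs_le] at this
    exact this
  refine h1.trans_lt ?_
  rw [← lintegral_indicator_one measurableSet_Icc, lintegral_pim n _
    (measurable_one.indicator measurableSet_Icc)]
  set S := {p : Hspace n | NN n p ≤ Real.exp (4 * M)} ∩ {p : Hspace n | Real.exp (-(4 * M)) ≤ NN n p}
  have hS : IsCompact S := (NN_le_isCompact n _).inter_right
    (isClosed_le continuous_const (NN_contDiff n).continuous)
  have hc : ContinuousOn (wt n) S := by
    unfold wt
    refine (zSq_contDiff n).continuous.continuousOn.mul
      ((NN_contDiff n).continuous.continuousOn.rpow_const fun p hp => Or.inl ?_)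
    exact (lt_of_lt_of_le (Real.exp_pos _) hp.2).ne'
  obtain ⟨B, hB⟩ := hS.exists_bound_of_continuousOn hc
  have hle : ∀ p, ENNReal.ofReal (wt n p) * (Set.Icc (-M) M).indicator 1 (LL n p) ≤
      S.indicator (fun _ => ENNReal.ofReal B) p := by
    intro p
    by_cases h0 : NN n p = 0
    · simp [wt_of_NN n p h0]
    by_cases hL : LL n p ∈ Set.Icc (-M) M
    · have hpos : 0 < NN n p := lt_of_le_of_ne (NN_nonneg n p) (Ne.symm h0)
      have hp : p ∈ S := by
        have h1 := hL.1
        have h2 := hL.2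
        unfold LL at h1 h2
        constructor
        · exact (Real.log_le_iff_le_exp hpos).1 (by linarith)
        · exact (Real.le_log_iff_exp_le hpos).1 (by linarith)
      rw [Set.indicator_of_mem hL, Set.indicator_of_mem hp]
      simp only [Pi.one_apply, mul_one]
      exact ENNReal.ofReal_le_ofReal ((le_abs_self _).trans (hB p hp))
    · rw [Set.indicator_of_notMem hL]; simp
  refine (lintegral_mono hle).trans_lt ?_
  rw [lintegral_indicator hS.measurableSet, setLIntegral_const]
  exact ENNReal.mul_lt_top ENNReal.ofReal_lt_top hS.measure_lt_top

lemma pim_ne (n : ℕ) (hn : 1 ≤ n) : pim n ≠ 0 := by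
  intro h
  have h1 := lintegral_pim n (fun _ => 1) measurable_const
  rw [h] at h1
  simp only [lintegral_zero_measure, mul_one] at h1
  have h2 := (lintegral_eq_zero_iff (wt_meas n).ennreal_ofReal).1 h1.symm
  have ho : IsOpen {p : Hspace n | 0 < zSq n p} :=
    isOpen_lt continuous_const (zSq_contDiff n).continuous
  have hne : {p : Hspace n | 0 < zSq n p}.Nonempty := by
    refine ⟨(fun _ => 1, 0, 0), ?_⟩
    simp [zSq]; omega
  have hp := ho.measure_pos volume hne
  refine hp.ne' (measure_mono_null ?_ h2)
  intro p hp
  have hp : 0 < zSq n p := hp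
  have hN : 0 < NN n p := by unfold NN; positivity
  have : 0 < wt n p := by unfold wt; positivity
  simpa using this

lemma pim_eq (n : ℕ) (hn : 1 ≤ n) : ∃ c : ENNReal, c ≠ 0 ∧ c ≠ ⊤ ∧ pim n = c • volume := by
  have h := Measure.isAddLeftInvariant_eq_smul (pim n) volume
  refine ⟨_, ?_, ?_, h⟩
  · intro h0
    apply pim_ne n hn
    rw [h]
    ext s hs
    simp [h0]
  · simp

lemma exists_h : ∃ h : ℝ → ℝ, ContDiff ℝ (⊤ : ℕ∞) h ∧ HasCompactSupport h ∧ h 0 ≠ 0 := by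
  obtain ⟨f, _, h2, h3, _, h5⟩ := exists_contDiff_tsupport_subset (n := (⊤ : ℕ∞))
    (s := (Set.univ : Set ℝ)) (x := 0) Filter.univ_mem
  exact ⟨f, h3, h2, by rw [h5]; norm_num⟩

lemma exists_g (β C : ℝ) (hC : β ^ 2 < C) : ∃ g : ℝ → ℝ, ContDiff ℝ (⊤ : ℕ∞) g ∧
    HasCompactSupport g ∧ 0 < ∫ s, g s ^ 2 ∧
    ∫ s, (deriv g s - β * g s) ^ 2 < C * ∫ s, g s ^ 2 := by
  obtain ⟨h, hh, hc, h0⟩ := exists_h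
  have hhc : Continuous h := hh.continuous
  have hdc : Continuous (deriv h) := hh.continuous_deriv (by simp)
  have hcd : HasCompactSupport (deriv h) := hc.deriv
  have c2 : ∀ f : ℝ → ℝ, HasCompactSupport f → HasCompactSupport (fun s => f s ^ 2) :=
    fun f hf => hf.comp_left (g := fun x : ℝ => x ^ 2) (by simp)
  have k1 : Continuous (fun s => h s ^ 2) := by fun_prop
  have k2 : Continuous (fun s => deriv h s ^ 2) := by fun_prop
  have iD : Integrable (fun s => h s ^ 2) := k1.integrable_of_hasCompactSupport (c2 h hc)
  have iA : Integrable (fun s => deriv h s ^ 2) := k2.integrable_of_hasCompactSupport (c2 _ hcd)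
  have iE : Integrable (fun s => h s * deriv h s) :=
    (hhc.mul hdc).integrable_of_hasCompactSupport (hc.mul_right)
  obtain ⟨D, hD⟩ : ∃ D, D = ∫ s, h s ^ 2 := ⟨_, rfl⟩
  obtain ⟨A, hA⟩ : ∃ D, D = ∫ s, deriv h s ^ 2 := ⟨_, rfl⟩
  obtain ⟨E, hE⟩ : ∃ D, D = ∫ s, h s * deriv h s := ⟨_, rfl⟩
  have Dpos : 0 < D := hD ▸
    Continuous.integral_pos_of_hasCompactSupport_nonneg_nonzero k1 (c2 h hc) (fun x => sq_nonneg _)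
      (x := 0) (pow_ne_zero 2 h0)
  have lim : Filter.Tendsto (fun R : ℝ => A * (R⁻¹) ^ 2 - 2 * β * E * R⁻¹) Filter.atTop
      (nhds (A * 0 ^ 2 - 2 * β * E * 0)) :=
    ((tendsto_inv_atTop_zero.pow 2).const_mul A).sub (tendsto_inv_atTop_zero.const_mul _)
  have hpos : A * 0 ^ 2 - 2 * β * E * 0 < (C - β ^ 2) * D := by
    have : 0 < (C - β ^ 2) * D := mul_pos (by linarith) Dpos
    simpa using this
  obtain ⟨R, hR, hR0⟩ := ((lim.eventually_lt_const hpos).and (Filter.eventually_gt_atTop 0)).exists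
  have e1 : ∫ s, h (s / R) ^ 2 = R * D := by
    rw [Measure.integral_comp_div (fun s => h s ^ 2) R, abs_of_pos hR0, hD]; rfl
  have hder : ∀ s, deriv (fun s => h (s / R)) s = R⁻¹ * deriv h (s / R) := by
    intro s
    have h1 : HasDerivAt h (deriv h (s / R)) (s / R) :=
      (hh.differentiable (by simp) _).hasDerivAt
    have h2 : HasDerivAt (fun s : ℝ => s / R) (1 / R) s := (hasDerivAt_id s).div_const R
    have h3 : HasDerivAt (fun s => h (s / R)) _ s := h1.comp s h2
    rw [h3.deriv]
    ring
  have e2 : ∫ s, (deriv (fun s => h (s / R)) s - β * h (s / R)) ^ 2 =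
      R * (A * (R⁻¹) ^ 2 - 2 * β * E * R⁻¹ + β ^ 2 * D) := by
    simp_rw [hder]
    rw [Measure.integral_comp_div (fun s => (R⁻¹ * deriv h s - β * h s) ^ 2) R, abs_of_pos hR0,
      smul_eq_mul]
    congr 1
    have : ∀ s, (R⁻¹ * deriv h s - β * h s) ^ 2 = (R⁻¹) ^ 2 * deriv h s ^ 2
        - (2 * β * R⁻¹) * (h s * deriv h s) + β ^ 2 * h s ^ 2 := fun s => by ring
    simp_rw [this]
    have i3 : Integrable (fun s => (R⁻¹) ^ 2 * deriv h s ^ 2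
        - (2 * β * R⁻¹) * (h s * deriv h s)) := (iA.const_mul _).sub (iE.const_mul _)
    rw [integral_add i3 (iD.const_mul _),
      integral_sub (iA.const_mul _) (iE.const_mul _), integral_const_mul, integral_const_mul,
      integral_const_mul, ← hA, ← hE, ← hD]
    ring
  refine ⟨fun s => h (s / R), by fun_prop, ?_, ?_, ?_⟩
  · have := hc.comp_homeomorph (Homeomorph.mulRight₀ R⁻¹ (inv_ne_zero hR0.ne'))
    simpa [Function.comp_def, div_eq_mul_inv] using this
  · simp only [e1]; positivity
  · simp only [e1, e2]
    have := mul_lt_mul_of_pos_left hR hR0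
    linear_combination this

def phi (n : ℕ) (G : ℝ → ℝ) (p : Hspace n) : ℝ := if NN n p = 0 then 0 else G (LL n p)

section
variable (n : ℕ) (G : ℝ → ℝ) (hG : ContDiff ℝ (⊤ : ℕ∞) G) (hGc : HasCompactSupport G)

lemma G_zero (hGc : HasCompactSupport G) : ∃ M : ℝ, ∀ s, M < |s| → G s = 0 := by
  obtain ⟨M, hM⟩ := hGc.isCompact.isBounded.exists_norm_le
  refine ⟨M, fun s hs => ?_⟩
  by_contra h
  exact absurd (hM s (subset_tsupport _ h)) (not_le.2 hs)

lemma phi_zero (hGc : HasCompactSupport G) (p : Hspace n) (hp : NN n p = 0) :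
    phi n G =ᶠ[nhds p] fun _ => 0 := by
  obtain ⟨M, hM⟩ := G_zero G hGc
  have h1 : ∀ᶠ q in nhds p, NN n q < Real.exp (-(4 * |M|)) :=
    (NN_contDiff n).continuous.continuousAt.eventually_lt_const (by rw [hp]; positivity)
  filter_upwards [h1] with q hq
  unfold phi
  split_ifs with h
  · rfl
  · apply hM
    have hpos : 0 < NN n q := lt_of_le_of_ne (NN_nonneg n q) (Ne.symm h)
    have := (Real.log_lt_iff_lt_exp hpos).2 hq
    have h3 : LL n q < -|M| := by unfold LL; linarith
    have h4 := neg_le_abs (LL n q)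
    have h5 := le_abs_self M
    linarith

lemma phi_pos (p : Hspace n) (hp : NN n p ≠ 0) :
    phi n G =ᶠ[nhds p] fun q => G (LL n q) := by
  filter_upwards [(NN_contDiff n).continuous.continuousAt.eventually_ne hp] with q hq
  simp [phi, hq]

lemma phi_contDiff (hG : ContDiff ℝ (⊤ : ℕ∞) G) (hGc : HasCompactSupport G) :
    ContDiff ℝ (⊤ : ℕ∞) (phi n G) := by
  rw [contDiff_iff_contDiffAt]
  intro p
  by_cases hp : NN n p = 0
  · exact contDiffAt_const.congr_of_eventuallyEq (phi_zero n G hGc p hp)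
  · refine ContDiffAt.congr_of_eventuallyEq ?_ (phi_pos n G p hp)
    refine hG.contDiffAt.comp p ?_
    exact ((NN_contDiff n).contDiffAt.log hp).div_const 4

lemma phi_compact (hGc : HasCompactSupport G) : HasCompactSupport (phi n G) := by
  obtain ⟨M, hM⟩ := G_zero G hGc
  refine HasCompactSupport.intro (NN_le_isCompact n (Real.exp (4 * M))) fun q hq => ?_
  have hq : Real.exp (4 * M) < NN n q := not_le.1 hq
  have hpos := (Real.exp_pos _).trans hq
  unfold phi
  rw [if_neg hpos.ne']
  apply hM
  have := (Real.lt_log_iff_exp_lt hpos).2 hq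
  have h3 : M < LL n q := by unfold LL; linarith
  exact h3.trans_le (le_abs_self _)

lemma NN_zero : NN n 0 = 0 := by simp [NN, zSq]

lemma phi_tsupport (hGc : HasCompactSupport G) : (0 : Hspace n) ∉ tsupport (phi n G) := by
  rw [notMem_tsupport_iff_eventuallyEq]
  exact phi_zero n G hGc 0 (NN_zero n)

lemma phi_grad (hG : ContDiff ℝ (⊤ : ℕ∞) G) (p : Hspace n) (hp : NN n p ≠ 0) :
    gradH2 n (phi n G) p = deriv G (LL n p) ^ 2 * zSq n p * (NN n p)⁻¹ := by
  have h1 : HasFDerivAt (NN n) (fderiv ℝ (NN n) p) p :=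
    ((NN_contDiff n).differentiable (by simp) p).hasFDerivAt
  have h2 : HasDerivAt (fun u : ℝ => Real.log u / 4) ((NN n p)⁻¹ / 4) (NN n p) :=
    (Real.hasDerivAt_log hp).div_const 4
  have h3 : HasDerivAt G (deriv G (LL n p)) (Real.log (NN n p) / 4) :=
    (hG.differentiable (by simp) _).hasDerivAt
  have h4 := (HasDerivAt.comp (h₂ := G) (h := fun u : ℝ => Real.log u / 4) (NN n p) h3 h2).comp_hasFDerivAt p h1
  have h5 : HasFDerivAt (phi n G) _ p := h4.congr_of_eventuallyEq (phi_pos n G p hp)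
  rw [grad_comp n p (phi n G) (deriv G (LL n p) * ((NN n p)⁻¹ / 4))]
  · field_simp
    norm_num
  · intro v
    rw [h5.fderiv]
    simp

end

lemma lint (n : ℕ) (c : ENNReal) (hc : pim n = c • volume) (F : ℝ → ℝ) (hF : Continuous F)
    (hFc : HasCompactSupport F) (h0 : ∀ s, 0 ≤ F s) :
    ∫⁻ p, ENNReal.ofReal (wt n p * F (LL n p)) = c * ENNReal.ofReal (∫ s, F s) := by
  rw [ofReal_integral_eq_lintegral_ofReal (hF.integrable_of_hasCompactSupport hFc)
    (Filter.Eventually.of_forall h0), ← smul_eq_mul, ← lintegral_smul_measure, ← hc,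
    lintegral_pim n _ hF.measurable.ennreal_ofReal]
  congr 1; ext p
  have : 0 ≤ wt n p := mul_nonneg (zSq_nonneg n p) (Real.rpow_nonneg (NN_nonneg n p) _)
  rw [ENNReal.ofReal_mul this]

/-- sharpness of the constant `((Q + α − 2)/2)²` in the weighted Hardy
inequality on ℍⁿ: any larger constant `C` fails for some `φ ∈ C_c^∞(ℝ^{2n+1} \ {0})`. -/
theorem heisenberg_weighted_hardy_sharp (n : ℕ) (hn : 1 ≤ n) (Q α : ℝ)
    (hQ : Q = 2 * n + 2) (hα : Q + α - 2 > 0) (C : ℝ) (hC : C > ((Q + α - 2) / 2) ^ 2) :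
    ∃ φ : Hspace n → ℝ, ContDiff ℝ (⊤ : ℕ∞) φ ∧ HasCompactSupport φ ∧
      (0 : Hspace n) ∉ tsupport φ ∧
      0 < (∫⁻ p, ENNReal.ofReal (rho n p ^ (α - 4) * zSq n p * (φ p) ^ 2)) ∧
      (∫⁻ p, ENNReal.ofReal (rho n p ^ α * gradH2 n φ p)) <
        ENNReal.ofReal C *
          ∫⁻ p, ENNReal.ofReal (rho n p ^ (α - 4) * zSq n p * (φ p) ^ 2) := by
  obtain ⟨c, c0, ct, hc⟩ := pim_eq n hn
  set β := (Q + α - 2) / 2 with hβ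
  obtain ⟨g, hg, hgc, gpos, glt⟩ := exists_g β C hC
  set G : ℝ → ℝ := fun s => Real.exp (-β * s) * g s with hGdef
  have hG : ContDiff ℝ (⊤ : ℕ∞) G := by fun_prop
  have hGc : HasCompactSupport G := hgc.mul_left
  have hdG : ∀ s, deriv G s = Real.exp (-β * s) * (deriv g s - β * g s) := by
    intro s
    have h1 : HasDerivAt g (deriv g s) s := (hg.differentiable (by simp) _).hasDerivAt
    have h2 : HasDerivAt (fun s => Real.exp (-β * s)) (Real.exp (-β * s) * (-β * 1)) s :=
      ((hasDerivAt_id s).const_mul (-β)).exp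
    have h3 : HasDerivAt G _ s := h2.mul h1
    rw [h3.deriv]
    ring
  have hexp : ∀ p, NN n p ≠ 0 → Real.exp (-β * LL n p) ^ 2 = NN n p ^ (-β / 2) := by
    intro p hp
    have hpos : 0 < NN n p := lt_of_le_of_ne (NN_nonneg n p) (Ne.symm hp)
    rw [Real.rpow_def_of_pos hpos, ← Real.exp_nat_mul]
    congr 1; unfold LL; push_cast; ring
  have hw : ∀ p, NN n p ≠ 0 → NN n p ^ ((α - 4) / 4) * NN n p ^ (-β / 2) =
      NN n p ^ (-((n:ℝ) + 2) / 2) := by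
    intro p hp
    have hpos : 0 < NN n p := lt_of_le_of_ne (NN_nonneg n p) (Ne.symm hp)
    rw [← Real.rpow_add hpos]
    congr 1; rw [hβ, hQ]; ring
  have hw' : ∀ p, NN n p ≠ 0 → NN n p ^ (α / 4) * (NN n p)⁻¹ = NN n p ^ ((α - 4) / 4) := by
    intro p hp
    have hpos : 0 < NN n p := lt_of_le_of_ne (NN_nonneg n p) (Ne.symm hp)
    rw [← Real.rpow_neg_one, ← Real.rpow_add hpos]
    congr 1; ring
  have e1 : ∀ p, rho n p ^ (α - 4) * zSq n p * (phi n G p) ^ 2 = wt n p * (g (LL n p)) ^ 2 := by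
    intro p
    by_cases hp : NN n p = 0
    · simp [wt_of_NN n p hp, zSq_of_NN n p hp]
    · have : phi n G p = Real.exp (-β * LL n p) * g (LL n p) := by simp [phi, hp, hGdef]
      rw [this, rho_rpow, mul_pow, hexp p hp, wt, ← hw p hp]
      ring
  have e2 : ∀ p, rho n p ^ α * gradH2 n (phi n G) p =
      wt n p * (deriv g (LL n p) - β * g (LL n p)) ^ 2 := by
    intro p
    by_cases hp : NN n p = 0
    · rw [wt_of_NN n p hp, grad_comp n p (phi n G) 0]
      · simp
      · intro v
        rw [(phi_zero n G hGc p hp).fderiv_eq]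
        simp
    · rw [phi_grad n G hG p hp, hdG, rho_rpow, mul_pow, hexp p hp, wt, ← hw p hp, ← hw' p hp]
      ring
  have hdc : Continuous (deriv g) := hg.continuous_deriv (by simp)
  have hgcont := hg.continuous
  have i1 := lint n c hc (fun s => g s ^ 2) (by fun_prop)
    (hgc.comp_left (g := fun x => x ^ 2) (by simp)) (fun s => sq_nonneg _)
  have i2 := lint n c hc (fun s => (deriv g s - β * g s) ^ 2) (by fun_prop)
    ((hgc.deriv.sub (hgc.mul_left (f := fun _ => β))).comp_left (g := fun x => x ^ 2) (by simp))
    (fun s => sq_nonneg _)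
  refine ⟨phi n G, phi_contDiff n G hG hGc, phi_compact n G hGc, phi_tsupport n G hGc, ?_, ?_⟩
  · simp_rw [e1]
    rw [i1]
    exact ENNReal.mul_pos c0 (by simpa using gpos)
  · simp_rw [e1, e2]
    rw [i1, i2, mul_left_comm, ← ENNReal.ofReal_mul ((sq_nonneg β).trans hC.le)]
    refine (ENNReal.mul_lt_mul_iff_right c0 ct).2 ?_
    refine (ENNReal.ofReal_lt_ofReal_iff ?_).2 glt
    exact mul_pos ((sq_nonneg β).trans_lt hC) gpos
end
end

section
/- Let n ≥ 1, let Q = 2n + 2, and let 0 ≤ s ≤ 2. Then there exists a constant C > 0 such that for every real-valued φ ∈ C_c^∞(ℝ^{2n+1} \ {0}), the Caffarelli–Kohn–Nirenberg type inequality holds: ∫_{ℝ^{2n+1}} |∇_ℍ φ|² dz dt ≥ C ( ∫_{ℝ^{2n+1}} (|z|/ρ²)^s |φ|^{2(Q−s)/(Q−2)} dz dt )^{(Q−2)/(Q−s)}. -/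
open MeasureTheory Real

noncomputable section

lemma sq_interval_le (g : ℝ → ℝ) (hg : Continuous g) :
    (∫ s in (0:ℝ)..1, g s) ^ 2 ≤ ∫ s in (0:ℝ)..1, (g s) ^ 2 := by
  set m := ∫ s in (0:ℝ)..1, g s with hm
  have h0 : 0 ≤ ∫ s in (0:ℝ)..1, (g s - m) ^ 2 :=
    intervalIntegral.integral_nonneg (by norm_num) (fun _ _ => sq_nonneg _)
  have h1 : (∫ s in (0:ℝ)..1, (g s - m) ^ 2)
      = (∫ s in (0:ℝ)..1, (g s) ^ 2) - 2 * m * m + m ^ 2 := by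
    have : ∀ s, (g s - m) ^ 2 = (g s ^ 2 - 2 * m * g s) + m ^ 2 := fun s => by ring
    simp_rw [this]
    rw [intervalIntegral.integral_add, intervalIntegral.integral_sub,
      intervalIntegral.integral_const_mul, intervalIntegral.integral_const]
    · simp [← hm]
    all_goals exact Continuous.intervalIntegrable (by fun_prop) _ _
  nlinarith

/-- Shears are measure preserving. -/
lemma mp_shear (n : ℕ) (v w : Fin n → ℝ) (c : (Fin n → ℝ) → (Fin n → ℝ) → ℝ)
    (hc : Continuous (fun q : (Fin n → ℝ) × (Fin n → ℝ) => c q.1 q.2)) :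
    MeasurePreserving (fun p : Hspace n => ((p.1 + v, p.2.1 + w, p.2.2 + c p.1 p.2.1) : Hspace n))
      volume volume := by
  have h1 : MeasurePreserving (fun x : Fin n → ℝ => x + v) volume volume :=
    measurePreserving_add_right volume v
  have h2 : MeasurePreserving (fun x : Fin n → ℝ => x + w) volume volume :=
    measurePreserving_add_right volume w
  refine MeasurePreserving.skew_product (g := fun x (q : (Fin n → ℝ) × ℝ) =>
    ((q.1 + w, q.2 + c x q.1) : (Fin n → ℝ) × ℝ)) h1 ?_ (Filter.Eventually.of_forall ?_)
  · apply Continuous.measurable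
    have : Continuous (fun p : Hspace n => c p.1 p.2.1) :=
      hc.comp (by fun_prop : Continuous (fun p : Hspace n => (p.1, p.2.1)))
    simp only [Function.uncurry_def]
    fun_prop
  · intro x
    refine (MeasurePreserving.skew_product (g := fun y (t : ℝ) => t + c x y) h2 ?_
      (Filter.Eventually.of_forall ?_)).map_eq
    · apply Continuous.measurable
      have : Continuous (fun p : (Fin n → ℝ) × ℝ => c x p.1) :=
        hc.comp (by fun_prop : Continuous (fun p : (Fin n → ℝ) × ℝ => (x, p.1)))
      simp only [Function.uncurry_def]
      fun_prop
    · intro y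
      exact (measurePreserving_add_right volume (c x y)).map_eq

/-- dot product -/
def dotp (n : ℕ) (x y : Fin n → ℝ) : ℝ := ∑ j, x j * y j

lemma continuous_dotp (n : ℕ) :
    Continuous (fun q : (Fin n → ℝ) × (Fin n → ℝ) => dotp n q.1 q.2) := by
  unfold dotp; fun_prop

@[fun_prop]
lemma Continuous.dotp' {α : Type*} [TopologicalSpace α] {n : ℕ} {f g : α → (Fin n → ℝ)}
    (hf : Continuous f) (hg : Continuous g) : Continuous (fun a => dotp n (f a) (g a)) :=
  (continuous_dotp n).comp (hf.prodMk hg)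

def flA (n : ℕ) (v : Fin n → ℝ) (p : Hspace n) : Hspace n :=
  (p.1 + v, p.2.1 + 0, p.2.2 + 2 * dotp n p.2.1 v)
def flB (n : ℕ) (w : Fin n → ℝ) (p : Hspace n) : Hspace n :=
  (p.1 + 0, p.2.1 + w, p.2.2 + -2 * dotp n p.1 w)

lemma mp_flA (n : ℕ) (v : Fin n → ℝ) : MeasurePreserving (flA n v) volume volume :=
  mp_shear n v 0 (fun _ y => 2 * dotp n y v) (by fun_prop)
lemma mp_flB (n : ℕ) (v : Fin n → ℝ) : MeasurePreserving (flB n v) volume volume :=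
  mp_shear n 0 v (fun x _ => -2 * dotp n x v) (by fun_prop)

/-- L² displacement. -/
def disp (n : ℕ) (f : Hspace n → ℝ) (Φ : Hspace n → Hspace n) : ENNReal :=
  ∫⁻ p, ENNReal.ofReal ((f (Φ p) - f p) ^ 2)

lemma disp_flow (n : ℕ) (f g : Hspace n → ℝ) (hg : Continuous g)
    (Φ : ℝ → Hspace n → Hspace n) (hΦ : Continuous (fun q : ℝ × Hspace n => Φ q.1 q.2))
    (h0 : Φ 0 = id)
    (hmp : ∀ s, MeasurePreserving (Φ s) volume volume)
    (hd : ∀ p s, HasDerivAt (fun s => f (Φ s p)) (g (Φ s p)) s) :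
    disp n f (Φ 1) ≤ ∫⁻ p, ENNReal.ofReal (g p ^ 2) := by
  have hgΦ : Continuous (fun q : ℝ × Hspace n => g (Φ q.1 q.2)) := hg.comp hΦ
  have hgp : ∀ p, Continuous (fun s => g (Φ s p)) := fun p =>
    hgΦ.comp (by fun_prop : Continuous (fun s : ℝ => (s, p)))
  have key : ∀ p, ENNReal.ofReal ((f (Φ 1 p) - f p) ^ 2)
      ≤ ∫⁻ s in Set.Ioc (0:ℝ) 1, ENNReal.ofReal (g (Φ s p) ^ 2) := by
    intro p
    have h1 : ∫ s in (0:ℝ)..1, g (Φ s p) = f (Φ 1 p) - f p := by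
      rw [intervalIntegral.integral_eq_sub_of_hasDerivAt (fun s _ => hd p s)
        ((hgp p).intervalIntegrable _ _)]
      simp [h0]
    have h2 := sq_interval_le _ (hgp p)
    rw [h1] at h2
    refine (ENNReal.ofReal_le_ofReal h2).trans ?_
    rw [intervalIntegral.integral_of_le (by norm_num), ofReal_integral_eq_lintegral_ofReal]
    · exact (((hgp p).pow 2).integrableOn_Icc).mono_set Set.Ioc_subset_Icc_self
    · exact Filter.Eventually.of_forall (fun s => sq_nonneg _)
  have hm : Measurable (fun q : ℝ × Hspace n => ENNReal.ofReal (g (Φ q.1 q.2) ^ 2)) :=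
    ENNReal.measurable_ofReal.comp (hgΦ.pow 2).measurable
  calc disp n f (Φ 1) ≤ ∫⁻ p, ∫⁻ s in Set.Ioc (0:ℝ) 1, ENNReal.ofReal (g (Φ s p) ^ 2) :=
        lintegral_mono key
    _ = ∫⁻ s in Set.Ioc (0:ℝ) 1, ∫⁻ p, ENNReal.ofReal (g (Φ s p) ^ 2) := by
        rw [lintegral_lintegral_swap]
        exact (hm.comp measurable_swap).aemeasurable
    _ = ∫⁻ s in Set.Ioc (0:ℝ) 1, ∫⁻ p, ENNReal.ofReal (g p ^ 2) := by
        congr 1; ext s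
        exact (hmp s).lintegral_comp (f := fun p => ENNReal.ofReal (g p ^ 2))
          (ENNReal.measurable_ofReal.comp (hg.pow 2).measurable)
    _ = ∫⁻ p, ENNReal.ofReal (g p ^ 2) := by simp

lemma disp_comp (n : ℕ) (f : Hspace n → ℝ) (hf : Continuous f) (Φ Ψ : Hspace n → Hspace n)
    (hΦ : Measurable Φ) (hΨ : MeasurePreserving Ψ volume volume) :
    disp n f (Φ ∘ Ψ) ≤ 2 * disp n f Φ + 2 * disp n f Ψ := by
  have hm : Measurable (fun p => ENNReal.ofReal ((f (Φ p) - f p) ^ 2)) := by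
    have := hf.measurable
    fun_prop
  have e : disp n f Φ = ∫⁻ p, ENNReal.ofReal ((f (Φ (Ψ p)) - f (Ψ p)) ^ 2) :=
    (hΨ.lintegral_comp hm).symm
  have hm2 : Measurable (fun p => ENNReal.ofReal ((f (Φ (Ψ p)) - f (Ψ p)) ^ 2)) :=
    hm.comp hΨ.measurable
  rw [e]
  unfold disp
  rw [← lintegral_const_mul _ hm2, ← lintegral_const_mul, ← lintegral_add_left]
  · refine lintegral_mono fun p => ?_
    rw [show (2 : ENNReal) = ENNReal.ofReal 2 by simp, ← ENNReal.ofReal_mul (by norm_num),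
      ← ENNReal.ofReal_mul (by norm_num), ← ENNReal.ofReal_add (by positivity) (by positivity)]
    apply ENNReal.ofReal_le_ofReal
    simp only [Function.comp]
    nlinarith [sq_nonneg ((f (Φ (Ψ p)) - f (Ψ p)) - (f (Ψ p) - f p))]
  · exact (hm.comp hΨ.measurable).const_mul 2
  · have := hf.measurable
    have := hΨ.measurable
    fun_prop

lemma Xd_eq (n : ℕ) (j : Fin n) (f : Hspace n → ℝ) (p : Hspace n) :
    Xd n j f p = fderiv ℝ f p (Pi.single j 1, 0, 2 * p.2.1 j) := by
  have : ((Pi.single j 1, 0, 2 * p.2.1 j) : Hspace n)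
      = (Pi.single j 1, 0, 0) + (2 * p.2.1 j) • ((0, 0, 1) : Hspace n) := by
    ext <;> simp
  rw [this, map_add, map_smul]; rfl

lemma Yd_eq (n : ℕ) (j : Fin n) (f : Hspace n → ℝ) (p : Hspace n) :
    Yd n j f p = fderiv ℝ f p (0, Pi.single j 1, -2 * p.1 j) := by
  have : ((0, Pi.single j 1, -2 * p.1 j) : Hspace n)
      = (0, Pi.single j 1, 0) + (-2 * p.1 j) • ((0, 0, 1) : Hspace n) := by
    ext <;> simp
  rw [this, map_add, map_smul, Yd, smul_eq_mul]; ring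

lemma sum_Xd (n : ℕ) (v : Fin n → ℝ) (f : Hspace n → ℝ) (p : Hspace n) :
    ∑ j, v j * Xd n j f p = fderiv ℝ f p (v, 0, 2 * dotp n p.2.1 v) := by
  have : ((v, 0, 2 * dotp n p.2.1 v) : Hspace n)
      = ∑ j, v j • ((Pi.single j 1, 0, 2 * p.2.1 j) : Hspace n) := by
    refine Prod.ext ?_ (Prod.ext ?_ ?_)
    · simp only [Prod.fst_sum, Prod.smul_fst]
      ext i; simp [Finset.sum_apply, Pi.single_apply]
    · simp [Prod.snd_sum, Prod.fst_sum]
    · simp only [Prod.snd_sum, Prod.smul_snd, dotp, smul_eq_mul, Finset.mul_sum]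
      exact Finset.sum_congr rfl fun _ _ => by ring
  rw [this, map_sum]
  exact Finset.sum_congr rfl fun j _ => by rw [map_smul, Xd_eq, smul_eq_mul]

lemma sum_Yd (n : ℕ) (v : Fin n → ℝ) (f : Hspace n → ℝ) (p : Hspace n) :
    ∑ j, v j * Yd n j f p = fderiv ℝ f p (0, v, -2 * dotp n p.1 v) := by
  have : ((0, v, -2 * dotp n p.1 v) : Hspace n)
      = ∑ j, v j • ((0, Pi.single j 1, -2 * p.1 j) : Hspace n) := by
    refine Prod.ext ?_ (Prod.ext ?_ ?_)
    · simp [Prod.fst_sum]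
    · simp only [Prod.snd_sum, Prod.fst_sum, Prod.smul_fst, Prod.smul_snd]
      ext i; simp [Finset.sum_apply, Pi.single_apply]
    · simp only [Prod.snd_sum, Prod.smul_snd, dotp, smul_eq_mul, Finset.mul_sum]
      exact Finset.sum_congr rfl fun _ _ => by ring
  rw [this, map_sum]
  exact Finset.sum_congr rfl fun j _ => by rw [map_smul, Yd_eq, smul_eq_mul]

lemma continuous_Xd (n : ℕ) (j : Fin n) (f : Hspace n → ℝ) (hf : ContDiff ℝ 1 f) :
    Continuous (Xd n j f) := by
  have h := hf.continuous_fderiv (by norm_num)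
  unfold Xd
  exact ((h.clm_apply continuous_const).add ((by fun_prop : Continuous fun p : Hspace n =>
    2 * p.2.1 j).mul (h.clm_apply continuous_const)))

lemma continuous_Yd (n : ℕ) (j : Fin n) (f : Hspace n → ℝ) (hf : ContDiff ℝ 1 f) :
    Continuous (Yd n j f) := by
  have h := hf.continuous_fderiv (by norm_num)
  unfold Yd
  exact ((h.clm_apply continuous_const).sub ((by fun_prop : Continuous fun p : Hspace n =>
    2 * p.1 j).mul (h.clm_apply continuous_const)))

lemma continuous_gradH2 (n : ℕ) (f : Hspace n → ℝ) (hf : ContDiff ℝ 1 f) :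
    Continuous (gradH2 n f) := by
  have h1 := fun j => continuous_Xd n j f hf
  have h2 := fun j => continuous_Yd n j f hf
  unfold gradH2
  fun_prop

lemma gradH2_nonneg (n : ℕ) (f : Hspace n → ℝ) (p : Hspace n) : 0 ≤ gradH2 n f p :=
  Finset.sum_nonneg fun _ _ => by positivity

/-- energy -/
def energy (n : ℕ) (f : Hspace n → ℝ) : ENNReal := ∫⁻ p, ENNReal.ofReal (gradH2 n f p)

lemma sum_mul_sq_le (n : ℕ) (r : ℝ) (v a : Fin n → ℝ) (hv : ∀ j, |v j| ≤ r) :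
    (∑ j, v j * a j) ^ 2 ≤ n * r ^ 2 * ∑ j, a j ^ 2 := by
  refine (Finset.sum_mul_sq_le_sq_mul_sq _ _ _).trans ?_
  refine mul_le_mul_of_nonneg_right ?_ (Finset.sum_nonneg fun _ _ => sq_nonneg _)
  calc ∑ j, v j ^ 2 ≤ ∑ _j : Fin n, r ^ 2 :=
        Finset.sum_le_sum fun j _ => by
          rw [← sq_abs]; exact pow_le_pow_left₀ (abs_nonneg _) (hv j) 2
    _ = n * r ^ 2 := by simp

lemma disp_le_energy (n : ℕ) (f g : Hspace n → ℝ) (K : ℝ) (hK : 0 ≤ K)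
    (Φ : Hspace n → Hspace n)
    (h : disp n f Φ ≤ ∫⁻ p, ENNReal.ofReal (g p ^ 2)) (hg : ∀ p, g p ^ 2 ≤ K * gradH2 n f p) :
    disp n f Φ ≤ ENNReal.ofReal K * energy n f := by
  refine h.trans ?_
  unfold energy
  rw [← lintegral_const_mul' _ _ ENNReal.ofReal_ne_top]
  refine lintegral_mono fun p => ?_
  rw [← ENNReal.ofReal_mul hK]
  exact ENNReal.ofReal_le_ofReal (hg p)

lemma disp_flA (n : ℕ) (f : Hspace n → ℝ) (hf : ContDiff ℝ 1 f) (r : ℝ) (v : Fin n → ℝ)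
    (hv : ∀ j, |v j| ≤ r) : disp n f (flA n v) ≤ ENNReal.ofReal (n * r ^ 2) * energy n f := by
  have h1 := fun j => continuous_Xd n j f hf
  have := disp_flow n f (fun p => ∑ j, v j * Xd n j f p) (by fun_prop)
    (fun s => flA n (s • v)) (by unfold flA; fun_prop) (by ext p <;> simp [flA, dotp])
    (fun s => mp_flA n _) ?_
  · simp only [one_smul] at this
    refine disp_le_energy n f _ _ (by positivity) _ this fun p => ?_
    refine (sum_mul_sq_le n r v _ hv).trans ?_
    refine mul_le_mul_of_nonneg_left ?_ (by positivity)
    exact Finset.sum_le_sum fun j _ => by nlinarith [sq_nonneg (Yd n j f p)]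
  · intro p s
    rw [sum_Xd]
    have e : ∀ s : ℝ, flA n (s • v) p = p + s • ((v, 0, 2 * dotp n p.2.1 v) : Hspace n) := by
      intro s
      refine Prod.ext ?_ (Prod.ext ?_ ?_) <;> simp [flA, dotp, Finset.mul_sum]
      exact Finset.sum_congr rfl fun _ _ => by ring
    have e2 : (flA n (s • v) p).2.1 = p.2.1 := by simp [flA]
    rw [e2]
    simp_rw [e]
    have hd := (hf.differentiable (by norm_num)
      (p + s • ((v, 0, 2 * dotp n p.2.1 v) : Hspace n))).hasFDerivAt
    have hl : HasDerivAt (fun s : ℝ => p + s • ((v, 0, 2 * dotp n p.2.1 v) : Hspace n))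
        ((v, 0, 2 * dotp n p.2.1 v) : Hspace n) s := by
      simpa using ((hasDerivAt_id s).smul_const ((v, 0, 2 * dotp n p.2.1 v) : Hspace n)).const_add p
    exact hd.comp_hasDerivAt s hl

lemma disp_flB (n : ℕ) (f : Hspace n → ℝ) (hf : ContDiff ℝ 1 f) (r : ℝ) (v : Fin n → ℝ)
    (hv : ∀ j, |v j| ≤ r) : disp n f (flB n v) ≤ ENNReal.ofReal (n * r ^ 2) * energy n f := by
  have h1 := fun j => continuous_Yd n j f hf
  have := disp_flow n f (fun p => ∑ j, v j * Yd n j f p) (by fun_prop)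
    (fun s => flB n (s • v)) (by unfold flB; fun_prop) (by ext p <;> simp [flB, dotp])
    (fun s => mp_flB n _) ?_
  · simp only [one_smul] at this
    refine disp_le_energy n f _ _ (by positivity) _ this fun p => ?_
    refine (sum_mul_sq_le n r v _ hv).trans ?_
    refine mul_le_mul_of_nonneg_left ?_ (by positivity)
    exact Finset.sum_le_sum fun j _ => by nlinarith [sq_nonneg (Xd n j f p)]
  · intro p s
    rw [sum_Yd]
    have e : ∀ s : ℝ, flB n (s • v) p = p + s • ((0, v, -2 * dotp n p.1 v) : Hspace n) := by
      intro s
      refine Prod.ext ?_ (Prod.ext ?_ ?_) <;> simp [flB, dotp, Finset.mul_sum]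
      exact Finset.sum_congr rfl fun _ _ => by ring
    have e2 : (flB n (s • v) p).1 = p.1 := by simp [flB]
    rw [e2]
    simp_rw [e]
    have hd := (hf.differentiable (by norm_num)
      (p + s • ((0, v, -2 * dotp n p.1 v) : Hspace n))).hasFDerivAt
    have hl : HasDerivAt (fun s : ℝ => p + s • ((0, v, -2 * dotp n p.1 v) : Hspace n))
        ((0, v, -2 * dotp n p.1 v) : Hspace n) s := by
      simpa using ((hasDerivAt_id s).smul_const ((0, v, -2 * dotp n p.1 v) : Hspace n)).const_add p
    exact hd.comp_hasDerivAt s hl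

/-- `Φ` is measure preserving with displacement at most `c r² E`. -/
def Good (n : ℕ) (f : Hspace n → ℝ) (r c : ℝ) (Φ : Hspace n → Hspace n) : Prop :=
  MeasurePreserving Φ volume volume ∧ disp n f Φ ≤ ENNReal.ofReal (c * (n * r ^ 2)) * energy n f

lemma Good.comp {n : ℕ} {f : Hspace n → ℝ} {r c d : ℝ} {Φ Ψ : Hspace n → Hspace n}
    (hf : Continuous f) (hc : 0 ≤ c) (hd : 0 ≤ d)
    (h1 : Good n f r c Φ) (h2 : Good n f r d Ψ) : Good n f r (2 * c + 2 * d) (Φ ∘ Ψ) := by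
  refine ⟨h1.1.comp h2.1, (disp_comp n f hf Φ Ψ h1.1.measurable h2.1).trans ?_⟩
  calc _ ≤ 2 * (ENNReal.ofReal (c * (n * r ^ 2)) * energy n f)
        + 2 * (ENNReal.ofReal (d * (n * r ^ 2)) * energy n f) := by
          gcongr
          · exact h1.2
          · exact h2.2
    _ = _ := by
      rw [show (2 : ENNReal) = ENNReal.ofReal 2 by simp, ← mul_assoc (ENNReal.ofReal 2),
        ← mul_assoc (ENNReal.ofReal 2), ← add_mul,
        ← ENNReal.ofReal_mul (by norm_num), ← ENNReal.ofReal_mul (by norm_num),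
        ← ENNReal.ofReal_add (by positivity) (by positivity)]
      congr 2; ring

/-- full translation -/
def htr (n : ℕ) (p h : Hspace n) : Hspace n :=
  (p.1 + h.1, p.2.1 + h.2.1, p.2.2 + 2 * dotp n p.2.1 h.1 - 2 * dotp n (p.1 + h.1) h.2.1 + h.2.2)

lemma continuous_trans (n : ℕ) :
    Continuous (fun q : Hspace n × Hspace n => htr n q.1 q.2) := by
  unfold htr; fun_prop

lemma mp_trans (n : ℕ) (p : Hspace n) : MeasurePreserving (htr n p) volume volume := by
  have := mp_shear n p.1 p.2.1
    (fun v w => p.2.2 + 2 * dotp n p.2.1 v - 2 * dotp n (p.1 + v) w) (by fun_prop)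
  convert this using 1
  ext h <;> simp [htr] <;> ring

lemma good_center (n : ℕ) (hn : 1 ≤ n) (f : Hspace n → ℝ) (hf : ContDiff ℝ 1 f) (r : ℝ)
    (hr : 0 ≤ r) (τ : ℝ) (hτ : |τ| ≤ r ^ 2) :
    Good n f r 16 (fun p => (p.1, p.2.1, p.2.2 + τ)) := by
  let j0 : Fin n := ⟨0, hn⟩
  have : ∃ a b : ℝ, |a| ≤ r ∧ |b| ≤ r ∧ -4 * a * b = τ := by
    have h1 : √|τ| ≤ r := Real.sqrt_le_iff.2 ⟨hr, hτ⟩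
    have h2 : √|τ| * √|τ| = |τ| := Real.mul_self_sqrt (abs_nonneg _)
    have h3 := Real.sqrt_nonneg |τ|
    rcases le_total 0 τ with h | h
    · refine ⟨√|τ| / 2, -(√|τ| / 2), ?_, ?_, ?_⟩
      · rw [abs_of_nonneg (by positivity)]; linarith
      · rw [abs_neg, abs_of_nonneg (by positivity)]; linarith
      · rw [abs_of_nonneg h] at *; linarith
    · refine ⟨√|τ| / 2, (√|τ| / 2), ?_, ?_, ?_⟩
      · rw [abs_of_nonneg (by positivity)]; linarith
      · rw [abs_of_nonneg (by positivity)]; linarith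
      · rw [abs_of_nonpos h] at *; linarith
  obtain ⟨a, b, ha, hb, hab⟩ := this
  have hs : ∀ a : ℝ, |a| ≤ r → ∀ j, |(Pi.single j0 a : Fin n → ℝ) j| ≤ r := by
    intro a ha j
    by_cases h : j = j0
    · subst h; simpa using ha
    · simp [h, hr]
  have gA : ∀ a : ℝ, |a| ≤ r → Good n f r 1 (flA n (Pi.single j0 a)) := fun a ha =>
    ⟨mp_flA _ _, by simpa using disp_flA n f hf r _ (hs a ha)⟩
  have gB : ∀ a : ℝ, |a| ≤ r → Good n f r 1 (flB n (Pi.single j0 a)) := fun a ha =>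
    ⟨mp_flB _ _, by simpa using disp_flB n f hf r _ (hs a ha)⟩
  have hfc := hf.continuous
  have h1 := (gB b hb).comp hfc (by norm_num) (by norm_num) (gA a ha)
  have h2 := (gB (-b) (by simpa using hb)).comp hfc (by norm_num) (by norm_num)
    (gA (-a) (by simpa using ha))
  have h3 := h2.comp hfc (by norm_num) (by norm_num) h1
  have e : (flB n (Pi.single j0 (-b)) ∘ flA n (Pi.single j0 (-a))) ∘
      (flB n (Pi.single j0 b) ∘ flA n (Pi.single j0 a)) = fun p => (p.1, p.2.1, p.2.2 + τ) := by
    have hd : ∀ (x : Fin n → ℝ) (c : ℝ), dotp n x (Pi.single j0 c) = x j0 * c := by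
      intro x c; simp [dotp, Pi.single_apply]
    ext p i <;> simp only [Function.comp, flA, flB, hd]
    · by_cases h : i = j0
      · subst h; simp
      · simp [h]
    · by_cases h : i = j0
      · subst h; simp
      · simp [h]
    · simp; linarith
  rw [e] at h3
  refine ⟨h3.1, h3.2.trans ?_⟩
  gcongr; norm_num

lemma good_trans (n : ℕ) (hn : 1 ≤ n) (f : Hspace n → ℝ) (hf : ContDiff ℝ 1 f) (r : ℝ)
    (hr : 0 ≤ r) (h : Hspace n) (h1 : ∀ j, |h.1 j| ≤ r) (h2 : ∀ j, |h.2.1 j| ≤ r)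
    (h3 : |h.2.2| ≤ r ^ 2) :
    Good n f r 40 (fun p => htr n p h) := by
  have gA : Good n f r 1 (flA n h.1) := ⟨mp_flA _ _, by simpa using disp_flA n f hf r _ h1⟩
  have gB : Good n f r 1 (flB n h.2.1) := ⟨mp_flB _ _, by simpa using disp_flB n f hf r _ h2⟩
  have hfc := hf.continuous
  have g := (good_center n hn f hf r hr h.2.2 h3).comp hfc (by norm_num) (by norm_num)
    (gB.comp hfc (by norm_num) (by norm_num) gA)
  have e : (fun p : Hspace n => ((p.1, p.2.1, p.2.2 + h.2.2) : Hspace n)) ∘ (flB n h.2.1 ∘ flA n h.1)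
      = fun p => htr n p h := by
    ext p i <;> simp [Function.comp, flA, flB, htr]
    ring
  rw [e] at g
  refine ⟨g.1, g.2.trans ?_⟩
  gcongr; norm_num

lemma vol_box (n : ℕ) (r : ℝ) (hr : 0 ≤ r) :
    volume ((Metric.closedBall (0 : Fin n → ℝ) r) ×ˢ ((Metric.closedBall (0 : Fin n → ℝ) r) ×ˢ
      (Metric.closedBall (0 : ℝ) (r ^ 2)))) = ENNReal.ofReal (2 * (4 ^ n * r ^ (2 * n + 2))) := by
  rw [Measure.volume_eq_prod, Measure.prod_prod, Measure.volume_eq_prod, Measure.prod_prod,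
    Real.volume_pi_closedBall _ hr, Real.volume_closedBall, ← ENNReal.ofReal_mul (by positivity),
    ← ENNReal.ofReal_mul (by positivity)]
  congr 1
  simp only [Fintype.card_fin]
  rw [show (4 : ℝ) = 2 * 2 by norm_num]
  simp only [mul_pow, pow_add, pow_mul']
  ring

lemma level_lemma (n : ℕ) (hn : 1 ≤ n) (g : Hspace n → ℝ) (hg : ContDiff ℝ 1 g)
    (S T : Set (Hspace n)) (hS : MeasurableSet S) (hT : MeasurableSet T) (a : ℝ) (ha : 0 < a)
    (hSa : volume S ≤ ENNReal.ofReal a) (hg1 : ∀ p ∈ T, g p = 1) (hg0 : ∀ p ∉ S, g p = 0) :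
    volume T ≤ ENNReal.ofReal (80 * n * a ^ (2 / (2 * n + 2 : ℝ))) * energy n g := by
  set r : ℝ := (a / 4 ^ n) ^ (1 / (2 * n + 2 : ℝ)) with hrdef
  have hr : 0 < r := by positivity
  have hrQ : r ^ (2 * n + 2) = a / 4 ^ n := by
    rw [hrdef, ← Real.rpow_natCast, ← Real.rpow_mul (by positivity)]
    push_cast
    rw [one_div_mul_cancel (by positivity), Real.rpow_one]
  have hr2 : r ^ 2 ≤ a ^ (2 / (2 * n + 2 : ℝ)) := by
    rw [hrdef, ← Real.rpow_natCast, ← Real.rpow_mul (by positivity)]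
    rw [show 1 / (2 * n + 2 : ℝ) * ((2 : ℕ) : ℝ) = 2 / (2 * n + 2 : ℝ) by push_cast; ring]
    refine Real.rpow_le_rpow (by positivity) ?_ (by positivity)
    exact div_le_self ha.le (one_le_pow₀ (by norm_num))
  set B : Set (Hspace n) := (Metric.closedBall (0 : Fin n → ℝ) r) ×ˢ
    ((Metric.closedBall (0 : Fin n → ℝ) r) ×ˢ (Metric.closedBall (0 : ℝ) (r ^ 2))) with hB
  have hBm : MeasurableSet B := Metric.isClosed_closedBall.measurableSet.prod
    (Metric.isClosed_closedBall.measurableSet.prod Metric.isClosed_closedBall.measurableSet)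
  have hBv : volume B = ENNReal.ofReal (2 * a) := by
    rw [hB, vol_box n r hr.le, hrQ]
    congr 2
    field_simp
  have hgood : ∀ h ∈ B, disp n g (fun p => htr n p h)
      ≤ ENNReal.ofReal (40 * (n * r ^ 2)) * energy n g := by
    rintro ⟨v, w, τ⟩ ⟨h1, h2, h3⟩
    simp only [mem_closedBall_zero_iff] at h1 h2 h3
    refine (good_trans n hn g hg r hr.le (v, w, τ) ?_ ?_ ?_).2
    · intro j; exact (norm_le_pi_norm v j).trans h1
    · intro j; exact (norm_le_pi_norm w j).trans h2
    · exact h3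
  have hm : Measurable (fun q : Hspace n × Hspace n =>
      ENNReal.ofReal ((g (htr n q.1 q.2) - g q.1) ^ 2)) := by
    have := hg.continuous
    have h2 := continuous_trans n
    exact ENNReal.measurable_ofReal.comp
      (((this.comp h2).sub (this.comp continuous_fst)).pow 2).measurable
  have up : ∫⁻ p, ∫⁻ h in B, ENNReal.ofReal ((g (htr n p h) - g p) ^ 2)
      ≤ ENNReal.ofReal (40 * (n * r ^ 2)) * energy n g * ENNReal.ofReal (2 * a) := by
    rw [lintegral_lintegral_swap hm.aemeasurable]
    calc _ ≤ ∫⁻ h in B, ENNReal.ofReal (40 * (n * r ^ 2)) * energy n g :=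
          setLIntegral_mono' hBm hgood
      _ = _ := by rw [setLIntegral_const, hBv]
  have lo : ∀ p ∈ T, ENNReal.ofReal a ≤ ∫⁻ h in B, ENNReal.ofReal ((g (htr n p h) - g p) ^ 2) := by
    intro p hp
    have hpre : volume (htr n p ⁻¹' S) ≤ ENNReal.ofReal a := by
      rw [(mp_trans n p).measure_preimage hS.nullMeasurableSet]; exact hSa
    have hpm : MeasurableSet (htr n p ⁻¹' S) := (mp_trans n p).measurable hS
    calc ENNReal.ofReal a = ENNReal.ofReal (2 * a) - ENNReal.ofReal a := by
          rw [← ENNReal.ofReal_sub _ ha.le]; congr 1; ring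
      _ ≤ volume B - volume (htr n p ⁻¹' S) := by
          rw [hBv]; exact tsub_le_tsub_left hpre _
      _ ≤ volume (B \ (htr n p ⁻¹' S)) := le_measure_sdiff
      _ = ∫⁻ h in B \ (htr n p ⁻¹' S), 1 := by simp
      _ ≤ ∫⁻ h in B \ (htr n p ⁻¹' S), ENNReal.ofReal ((g (htr n p h) - g p) ^ 2) := by
          refine setLIntegral_mono' (hBm.diff hpm) fun h hh => ?_
          rw [hg1 p hp, hg0 _ hh.2]; simp
      _ ≤ _ := lintegral_mono_set Set.sdiff_subset
  have fin : ENNReal.ofReal a * volume T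
      ≤ ENNReal.ofReal a * (ENNReal.ofReal (80 * n * r ^ 2) * energy n g) := by
    calc ENNReal.ofReal a * volume T = ∫⁻ _p in T, ENNReal.ofReal a := by rw [setLIntegral_const]
      _ ≤ ∫⁻ p in T, ∫⁻ h in B, ENNReal.ofReal ((g (htr n p h) - g p) ^ 2) :=
          setLIntegral_mono' hT lo
      _ ≤ _ := setLIntegral_le_lintegral _ _
      _ ≤ _ := up
      _ = _ := by
        rw [mul_comm _ (ENNReal.ofReal (2 * a)), ← mul_assoc (ENNReal.ofReal (2 * a)),
          ← mul_assoc (ENNReal.ofReal a),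
          ← ENNReal.ofReal_mul (by positivity), ← ENNReal.ofReal_mul (by positivity)]
        congr 2; ring
  have h4 := (ENNReal.mul_le_mul_iff_right (by simpa using ha) ENNReal.ofReal_ne_top).1 fin
  refine h4.trans ?_
  gcongr

def etaF (u : ℝ) : ℝ := Real.smoothTransition (u - 2)

lemma etaF_contDiff : ContDiff ℝ 1 etaF := by
  unfold etaF
  exact (Real.smoothTransition.contDiff (n := 1)).comp (contDiff_id.sub contDiff_const)

lemma etaF_deriv_zero (u : ℝ) (hu : u < 2 ∨ 3 < u) : deriv etaF u = 0 := by
  rcases hu with hu | hu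
  · have : etaF =ᶠ[nhds u] fun _ => 0 := by
      filter_upwards [Iio_mem_nhds hu] with x hx
      exact Real.smoothTransition.zero_of_nonpos (by linarith [Set.mem_Iio.1 hx])
    rw [this.deriv_eq]; simp
  · have : etaF =ᶠ[nhds u] fun _ => 1 := by
      filter_upwards [Ioi_mem_nhds hu] with x hx
      exact Real.smoothTransition.one_of_one_le (by linarith [Set.mem_Ioi.1 hx])
    rw [this.deriv_eq]; simp

lemma etaF_deriv_bdd : ∃ K : ℝ, 0 < K ∧ ∀ u, |deriv etaF u| ≤ K := by
  have hc : Continuous (deriv etaF) := etaF_contDiff.continuous_deriv (by norm_num)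
  obtain ⟨K, hK⟩ := (isCompact_Icc (a := (2:ℝ)) (b := 3)).exists_bound_of_continuousOn
    hc.continuousOn
  refine ⟨max K 1, by positivity, fun u => ?_⟩
  by_cases hu : u ∈ Set.Icc (2:ℝ) 3
  · exact (hK u hu).trans (le_max_left _ _)
  · rw [etaF_deriv_zero u (by
      simp only [Set.mem_Icc, not_and_or, not_le] at hu; exact hu)]
    simp

lemma gradH2_comp (n : ℕ) (H : ℝ → ℝ) (hH : Differentiable ℝ H) (f : Hspace n → ℝ)
    (hf : Differentiable ℝ f) (p : Hspace n) :
    gradH2 n (fun p => H (f p)) p = (deriv H (f p)) ^ 2 * gradH2 n f p := by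
  have h : fderiv ℝ (fun p => H (f p)) p = deriv H (f p) • fderiv ℝ f p :=
    ((hH (f p)).hasDerivAt.comp_hasFDerivAt p (hf p).hasFDerivAt).fderiv
  unfold gradH2
  rw [Finset.mul_sum]
  refine Finset.sum_congr rfl fun j _ => ?_
  simp only [Xd, Yd, h, _root_.smul_apply, smul_eq_mul]
  ring

def cutF (m : ℝ) (x : ℝ) : ℝ := etaF (x ^ 2 / m ^ 2)

lemma cutF_contDiff (m : ℝ) : ContDiff ℝ 1 (cutF m) := by
  unfold cutF
  exact etaF_contDiff.comp ((contDiff_id.pow 2).div_const _)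

lemma cutF_deriv (m x : ℝ) : deriv (cutF m) x = deriv etaF (x ^ 2 / m ^ 2) * (2 * x / m ^ 2) := by
  have h1 : HasDerivAt (fun x : ℝ => x ^ 2 / m ^ 2) (2 * x / m ^ 2) x := by
    simpa using (hasDerivAt_pow 2 x).div_const (m ^ 2)
  exact ((etaF_contDiff.differentiable (by norm_num) _).hasDerivAt.comp x h1).deriv

lemma cutF_one (m x : ℝ) (hm : 0 < m) (h : 2 * m ≤ |x|) : cutF m x = 1 := by
  apply Real.smoothTransition.one_of_one_le
  have : 4 * m ^ 2 ≤ x ^ 2 := by rw [← sq_abs x]; nlinarith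
  have : 4 ≤ x ^ 2 / m ^ 2 := by rw [le_div_iff₀ (by positivity)]; linarith
  linarith

lemma cutF_zero (m x : ℝ) (hm : 0 < m) (h : |x| < m) : cutF m x = 0 := by
  apply Real.smoothTransition.zero_of_nonpos
  have : x ^ 2 ≤ m ^ 2 := by rw [← sq_abs x]; nlinarith [abs_nonneg x]
  have : x ^ 2 / m ^ 2 ≤ 1 := by rw [div_le_one (by positivity)]; linarith
  linarith

lemma cutF_deriv_sq (K m x : ℝ) (hK : ∀ u, |deriv etaF u| ≤ K) (hm : 0 < m) :
    deriv (cutF m) x ^ 2 ≤ 16 * K ^ 2 / m ^ 2 := by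
  rw [cutF_deriv]
  by_cases hu : x ^ 2 / m ^ 2 < 2 ∨ 3 < x ^ 2 / m ^ 2
  · rw [etaF_deriv_zero _ hu]; simp; positivity
  · push Not at hu
    have h1 : x ^ 2 ≤ 3 * m ^ 2 := (div_le_iff₀ (by positivity)).1 hu.2
    have h2 : deriv etaF (x ^ 2 / m ^ 2) ^ 2 ≤ K ^ 2 := by
      rw [← sq_abs]; exact pow_le_pow_left₀ (abs_nonneg _) (hK _) 2
    have h3 : (2 * x / m ^ 2) ^ 2 ≤ 16 / m ^ 2 := by
      rw [div_pow, div_le_div_iff₀ (by positivity) (by positivity)]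
      nlinarith [sq_nonneg m, mul_le_mul_of_nonneg_right h1 (sq_nonneg m)]
    calc _ = deriv etaF (x ^ 2 / m ^ 2) ^ 2 * (2 * x / m ^ 2) ^ 2 := by ring
      _ ≤ K ^ 2 * (16 / m ^ 2) := by gcongr
      _ = _ := by ring

lemma cutF_deriv_supp (m x : ℝ) (hm : 0 < m) (h : ¬ (m ≤ |x| ∧ |x| < 2 * m)) :
    deriv (cutF m) x = 0 := by
  rw [cutF_deriv, etaF_deriv_zero, zero_mul]
  by_contra hu
  push Not at hu
  have h1 : x ^ 2 ≤ 3 * m ^ 2 := (div_le_iff₀ (by positivity)).1 hu.2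
  have h2 : 2 * m ^ 2 ≤ x ^ 2 := (le_div_iff₀ (by positivity)).1 hu.1
  refine h ⟨abs_le_of_sq_le_sq' ?_ ?_ |>.2, ?_⟩
  · rw [sq_abs]; nlinarith
  · positivity
  · rw [← sq_abs] at h1
    nlinarith [abs_nonneg x]

def layer (n : ℕ) (f : Hspace n → ℝ) (k : ℤ) : Set (Hspace n) :=
  {p | |f p| ∈ Set.Ico ((2:ℝ) ^ k) (2 ^ (k + 1))}

lemma layer_meas (n : ℕ) (f : Hspace n → ℝ) (hf : Continuous f) (k : ℤ) :
    MeasurableSet (layer n f k) :=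
  hf.abs.measurable measurableSet_Ico

lemma layer_disj (n : ℕ) (f : Hspace n → ℝ) : Pairwise (Function.onFun Disjoint (layer n f)) := by
  have key : ∀ i j : ℤ, i < j → Disjoint (layer n f i) (layer n f j) := by
    intro i j hij
    rw [Set.disjoint_left]
    intro p h1 h2
    have : (2:ℝ) ^ (i + 1) ≤ 2 ^ j := zpow_le_zpow_right₀ (by norm_num) (by omega)
    exact absurd h1.2 (not_lt.2 (this.trans h2.1))
  intro i j hij
  rcases lt_or_gt_of_ne hij with h | h
  · exact key i j h
  · exact (key j i h).symm

lemma level_step (n : ℕ) (hn : 1 ≤ n) (K : ℝ) (hK : ∀ u, |deriv etaF u| ≤ K)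
    (f : Hspace n → ℝ) (hf : ContDiff ℝ 1 f) (k : ℤ) (q I : ℝ) (hI : 0 < I)
    (hq : q = 2 * (2 * n + 2) / (2 * n : ℝ))
    (hfI : ∫⁻ p, ENNReal.ofReal (|f p| ^ q) ≤ ENNReal.ofReal I) :
    ENNReal.ofReal (((2:ℝ) ^ k) ^ q) * volume {p | (2:ℝ) ^ (k + 1) ≤ |f p|} ≤
      ENNReal.ofReal (80 * n * (16 * K ^ 2) * I ^ (2 / (2 * n + 2 : ℝ))) *
        ∫⁻ p in layer n f k, ENNReal.ofReal (gradH2 n f p) := by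
  have hn0 : (0:ℝ) < n := by exact_mod_cast hn
  have hq0 : 0 < q := by rw [hq]; positivity
  set m : ℝ := (2:ℝ) ^ k with hm
  have hm0 : 0 < m := by positivity
  have hm2 : (2:ℝ) ^ (k + 1) = 2 * m := by rw [zpow_add_one₀ (by norm_num)]; ring
  have hfc := hf.continuous
  have hS : MeasurableSet {p | m ≤ |f p|} := hfc.abs.measurable measurableSet_Ici
  have hT : MeasurableSet {p | 2 * m ≤ |f p|} := hfc.abs.measurable measurableSet_Ici
  have hcheb : volume {p | m ≤ |f p|} ≤ ENNReal.ofReal (I / m ^ q) := by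
    have h1 : ENNReal.ofReal (m ^ q) * volume {p | m ≤ |f p|} ≤ ENNReal.ofReal I := by
      calc _ = ∫⁻ _p in {p | m ≤ |f p|}, ENNReal.ofReal (m ^ q) := by rw [setLIntegral_const]
        _ ≤ ∫⁻ p in {p | m ≤ |f p|}, ENNReal.ofReal (|f p| ^ q) :=
            setLIntegral_mono' hS fun p hp =>
              ENNReal.ofReal_le_ofReal (Real.rpow_le_rpow hm0.le hp hq0.le)
        _ ≤ _ := setLIntegral_le_lintegral _ _
        _ ≤ _ := hfI
    rw [ENNReal.ofReal_div_of_pos (by positivity), ENNReal.le_div_iff_mul_le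
      (Or.inl (by simp; positivity)) (Or.inl ENNReal.ofReal_ne_top), mul_comm]
    exact h1
  have h1 := level_lemma n hn (fun p => cutF m (f p)) ((cutF_contDiff m).comp hf)
    _ _ hS hT (I / m ^ q) (by positivity) hcheb (fun p hp => cutF_one m _ hm0 hp)
    (fun p hp => cutF_zero m _ hm0 (not_le.1 hp))
  have h2 : energy n (fun p => cutF m (f p)) ≤
      ENNReal.ofReal (16 * K ^ 2 / m ^ 2) *
        ∫⁻ p in layer n f k, ENNReal.ofReal (gradH2 n f p) := by
    rw [← lintegral_const_mul' _ _ ENNReal.ofReal_ne_top,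
      ← lintegral_indicator (layer_meas n f hfc k)]
    refine lintegral_mono fun p => ?_
    rw [gradH2_comp n _ ((cutF_contDiff m).differentiable (by norm_num)) f
      (hf.differentiable (by norm_num))]
    by_cases hp : p ∈ layer n f k
    · rw [Set.indicator_of_mem hp, ← ENNReal.ofReal_mul (by positivity)]
      exact ENNReal.ofReal_le_ofReal (mul_le_mul_of_nonneg_right
        (cutF_deriv_sq K m _ hK hm0) (gradH2_nonneg _ _ _))
    · rw [cutF_deriv_supp m (f p) hm0 (fun h => hp ⟨h.1, by rw [hm2]; exact h.2⟩)]
      simp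
  rw [hm2]
  calc _ ≤ ENNReal.ofReal (m ^ q) * (ENNReal.ofReal (80 * n * (I / m ^ q) ^ (2 / (2 * n + 2 : ℝ))) *
        (ENNReal.ofReal (16 * K ^ 2 / m ^ 2) *
        ∫⁻ p in layer n f k, ENNReal.ofReal (gradH2 n f p))) := by
        gcongr
        exact h1.trans (by gcongr)
    _ = _ := by
      rw [← mul_assoc, ← mul_assoc, ← ENNReal.ofReal_mul (by positivity),
        ← ENNReal.ofReal_mul (by positivity)]
      congr 2
      rw [Real.div_rpow hI.le (by positivity), ← Real.rpow_mul hm0.le]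
      have e : m ^ q = m ^ (q * (2 / (2 * n + 2 : ℝ))) * m ^ 2 := by
        rw [← Real.rpow_natCast, ← Real.rpow_add hm0]
        congr 1
        rw [hq]; push_cast; field_simp; ring
      rw [e]
      have : 0 < m ^ (q * (2 / (2 * n + 2 : ℝ))) := by positivity
      field_simp

theorem sobolevH (n : ℕ) (hn : 1 ≤ n) : ∃ K : ℝ, 0 < K ∧ ∀ f : Hspace n → ℝ, ContDiff ℝ 1 f →
    HasCompactSupport f →
    (∫⁻ p, ENNReal.ofReal (|f p| ^ (2 * (2 * n + 2) / (2 * n : ℝ)))) ^ ((2 * n) / (2 * n + 2 : ℝ))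
      ≤ ENNReal.ofReal K * energy n f := by
  have hn0 : (0:ℝ) < n := by exact_mod_cast hn
  obtain ⟨K, hK0, hK⟩ := etaF_deriv_bdd
  set q : ℝ := 2 * (2 * n + 2) / (2 * n : ℝ) with hq
  have hq0 : 0 < q := by positivity
  refine ⟨4 ^ q * (80 * n * (16 * K ^ 2)), by positivity, fun f hf hfs => ?_⟩
  have hfc := hf.continuous
  set J := ∫⁻ p, ENNReal.ofReal (|f p| ^ q) with hJ
  have hJfin : J ≠ ⊤ := by
    have hc : Continuous (fun p => |f p| ^ q) :=
      hfc.abs.rpow_const (fun _ => Or.inr hq0.le)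
    have hs : HasCompactSupport (fun p => |f p| ^ q) :=
      hfs.comp_left (g := fun x => |x| ^ q) (by simp [Real.zero_rpow hq0.ne'])
    have := (hc.integrable_of_hasCompactSupport hs (μ := volume)).lintegral_lt_top
    exact this.ne
  rcases eq_or_ne J 0 with h0 | h0
  · rw [h0, ENNReal.zero_rpow_of_pos (by positivity)]; exact zero_le
  have hI : 0 < J.toReal := ENNReal.toReal_pos h0 hJfin
  set I := J.toReal with hIdef
  have hJI : J = ENNReal.ofReal I := (ENNReal.ofReal_toReal hJfin).symm
  have step := fun k : ℤ => level_step n hn K hK f hf k q I hI hq hJI.le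
  have s1 : J ≤ ∑' k : ℤ, ∫⁻ p in layer n f k, ENNReal.ofReal (|f p| ^ q) := by
    refine le_trans ?_ (lintegral_iUnion_le _ _)
    rw [← lintegral_indicator (MeasurableSet.iUnion (layer_meas n f hfc))]
    refine lintegral_mono fun p => ?_
    by_cases hp : f p = 0
    · simp [hp, Real.zero_rpow hq0.ne']
    · rw [Set.indicator_of_mem]
      obtain ⟨k, hk⟩ := exists_mem_Ico_zpow (abs_pos.2 hp) (one_lt_two : (1:ℝ) < 2)
      exact Set.mem_iUnion.2 ⟨k, hk⟩
  have s2 : ∀ k : ℤ, ∫⁻ p in layer n f k, ENNReal.ofReal (|f p| ^ q)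
      ≤ ENNReal.ofReal (((2:ℝ) ^ (k + 1)) ^ q) * volume {p | (2:ℝ) ^ k ≤ |f p|} := by
    intro k
    calc _ ≤ ∫⁻ p in layer n f k, ENNReal.ofReal (((2:ℝ) ^ (k + 1)) ^ q) :=
          setLIntegral_mono' (layer_meas n f hfc k) fun p hp =>
            ENNReal.ofReal_le_ofReal (Real.rpow_le_rpow (abs_nonneg _) hp.2.le hq0.le)
      _ = ENNReal.ofReal (((2:ℝ) ^ (k + 1)) ^ q) * volume (layer n f k) := setLIntegral_const _ _
      _ ≤ _ := by
        gcongr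
        exact fun p hp => hp.1
  have s3 : J ≤ ENNReal.ofReal (4 ^ q * (80 * n * (16 * K ^ 2) * I ^ (2 / (2 * n + 2 : ℝ)))) *
      energy n f := by
    calc J ≤ ∑' k : ℤ, ENNReal.ofReal (((2:ℝ) ^ (k + 1)) ^ q) * volume {p | (2:ℝ) ^ k ≤ |f p|} :=
          s1.trans (ENNReal.tsum_le_tsum s2)
      _ = ∑' k : ℤ, ENNReal.ofReal (((2:ℝ) ^ (k + 1 + 1)) ^ q) *
            volume {p | (2:ℝ) ^ (k + 1) ≤ |f p|} :=
          ((Equiv.addRight (1:ℤ)).tsum_eq (fun k : ℤ => ENNReal.ofReal (((2:ℝ) ^ (k + 1)) ^ q) *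
            volume {p | (2:ℝ) ^ k ≤ |f p|})).symm
      _ ≤ ∑' k : ℤ, ENNReal.ofReal (4 ^ q * (80 * n * (16 * K ^ 2) * I ^ (2 / (2 * n + 2 : ℝ)))) *
            ∫⁻ p in layer n f k, ENNReal.ofReal (gradH2 n f p) := by
          refine ENNReal.tsum_le_tsum fun k => ?_
          have e : ((2:ℝ) ^ (k + 1 + 1)) ^ q = 4 ^ q * ((2:ℝ) ^ k) ^ q := by
            rw [← Real.mul_rpow (by norm_num) (by positivity)]
            congr 1
            rw [zpow_add_one₀ (by norm_num), zpow_add_one₀ (by norm_num)]; ring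
          rw [e, ENNReal.ofReal_mul (by positivity), mul_assoc, ENNReal.ofReal_mul (by positivity),
            mul_assoc]
          exact mul_le_mul_right (step k) _
      _ = ENNReal.ofReal (4 ^ q * (80 * n * (16 * K ^ 2) * I ^ (2 / (2 * n + 2 : ℝ)))) *
            ∫⁻ p in ⋃ k, layer n f k, ENNReal.ofReal (gradH2 n f p) := by
          rw [ENNReal.tsum_mul_left, lintegral_iUnion (layer_meas n f hfc) (layer_disj n f)]
      _ ≤ _ := by
          gcongr
          exact setLIntegral_le_lintegral _ _
  set θ : ℝ := 2 / (2 * n + 2 : ℝ) with hθ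
  have hpos : 0 < I ^ θ := by positivity
  have s4 : ENNReal.ofReal (I ^ θ) * ENNReal.ofReal (I ^ ((2 * n) / (2 * n + 2 : ℝ))) ≤
      ENNReal.ofReal (I ^ θ) * (ENNReal.ofReal (4 ^ q * (80 * n * (16 * K ^ 2))) * energy n f) := by
    rw [← ENNReal.ofReal_mul hpos.le, ← Real.rpow_add hI, ← mul_assoc,
      ← ENNReal.ofReal_mul hpos.le]
    have e1 : θ + (2 * n) / (2 * n + 2 : ℝ) = 1 := by rw [hθ]; field_simp; ring
    rw [e1, Real.rpow_one, ← hJI]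
    refine s3.trans (le_of_eq ?_)
    congr 2; ring
  have s5 := (ENNReal.mul_le_mul_iff_right (by simpa using hpos) ENNReal.ofReal_ne_top).1 s4
  rw [hJI, ENNReal.ofReal_rpow_of_pos hI]
  exact s5

lemma int_fderiv_zero (n : ℕ) (F c : Hspace n → ℝ) (hF : ContDiff ℝ 1 F) (hs : HasCompactSupport F)
    (hc : ContDiff ℝ 1 c) (v : Hspace n) (hv : ∀ p, fderiv ℝ c p v = 0) :
    ∫ p, c p * fderiv ℝ F p v = 0 ∧ Integrable (fun p => c p * fderiv ℝ F p v) := by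
  have hcc := hc.continuous
  have hFc := hF.continuous
  have h1 : Continuous (fun p => fderiv ℝ F p v) :=
    (hF.continuous_fderiv (by norm_num)).clm_apply continuous_const
  have h2 : HasCompactSupport (fun p => fderiv ℝ F p v) :=
    (hs.fderiv (𝕜 := ℝ)).comp_left (g := fun L : Hspace n →L[ℝ] ℝ => L v) (by simp)
  have i1 : Integrable (fun p => c p * fderiv ℝ F p v) :=
    (hcc.mul h1).integrable_of_hasCompactSupport (h2.mul_left)
  refine ⟨?_, i1⟩
  haveI i2 : Measure.IsAddHaarMeasure (volume : Measure ((Fin n → ℝ) × ℝ)) :=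
    Measure.prod.instIsAddHaarMeasure volume volume
  haveI i3 : Measure.IsAddHaarMeasure (volume : Measure (Hspace n)) :=
    Measure.prod.instIsAddHaarMeasure volume volume
  rw [integral_mul_fderiv_eq_neg_fderiv_mul_of_integrable]
  · simp [hv]
  · simp [hv]
  · exact i1
  · exact (hcc.mul hFc).integrable_of_hasCompactSupport (hs.mul_left)
  · exact fun p _ => hc.differentiable (by norm_num) p
  · exact fun p _ => hF.differentiable (by norm_num) p

lemma int_Xd_zero (n : ℕ) (j : Fin n) (F : Hspace n → ℝ) (hF : ContDiff ℝ 1 F)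
    (hs : HasCompactSupport F) : ∫ p, Xd n j F p = 0 ∧ Integrable (Xd n j F) := by
  have h1 := int_fderiv_zero n F (fun _ => 1) hF hs contDiff_const (Pi.single j 1, 0, 0)
    (by simp)
  have h2 := int_fderiv_zero n F (fun p => 2 * p.2.1 j) hF hs (by fun_prop) (0, 0, 1) (by
    intro p
    rw [← DifferentiableAt.lineDeriv_eq_fderiv (by fun_prop)]
    simp [lineDeriv])
  simp only [one_mul] at h1
  constructor
  · unfold Xd; rw [integral_add h1.2 h2.2, h1.1, h2.1, add_zero]
  · exact h1.2.add h2.2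

lemma int_Yd_zero (n : ℕ) (j : Fin n) (F : Hspace n → ℝ) (hF : ContDiff ℝ 1 F)
    (hs : HasCompactSupport F) : ∫ p, Yd n j F p = 0 ∧ Integrable (Yd n j F) := by
  have h1 := int_fderiv_zero n F (fun _ => 1) hF hs contDiff_const (0, Pi.single j 1, 0)
    (by simp)
  have h2 := int_fderiv_zero n F (fun p => 2 * p.1 j) hF hs (by fun_prop) (0, 0, 1) (by
    intro p
    rw [← DifferentiableAt.lineDeriv_eq_fderiv (by fun_prop)]
    simp [lineDeriv])
  simp only [one_mul] at h1
  constructor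
  · unfold Yd; rw [integral_sub h1.2 h2.2, h1.1, h2.1, sub_zero]
  · exact h1.2.sub h2.2

def Nd (n : ℕ) (δ : ℝ) (p : Hspace n) : ℝ := zSq n p ^ 2 + p.2.2 ^ 2 + δ
def WX (n : ℕ) (δ : ℝ) (j : Fin n) (p : Hspace n) : ℝ :=
  (zSq n p * p.1 j + p.2.1 j * p.2.2) / Nd n δ p
def WY (n : ℕ) (δ : ℝ) (j : Fin n) (p : Hspace n) : ℝ :=
  (zSq n p * p.2.1 j - p.1 j * p.2.2) / Nd n δ p

lemma Nd_pos (n : ℕ) (δ : ℝ) (hδ : 0 < δ) (p : Hspace n) : 0 < Nd n δ p := by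
  unfold Nd; positivity

lemma contDiff_zSq (n : ℕ) : ContDiff ℝ 1 (zSq n) := by
  unfold zSq
  exact ContDiff.sum fun j _ => by fun_prop

lemma contDiff_Nd (n : ℕ) (δ : ℝ) : ContDiff ℝ 1 (Nd n δ) := by
  have := contDiff_zSq n
  unfold Nd; fun_prop

lemma contDiff_WX (n : ℕ) (δ : ℝ) (hδ : 0 < δ) (j : Fin n) : ContDiff ℝ 1 (WX n δ j) := by
  have := contDiff_zSq n
  exact ContDiff.div (by fun_prop) (contDiff_Nd n δ) fun p => (Nd_pos n δ hδ p).ne'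

lemma contDiff_WY (n : ℕ) (δ : ℝ) (hδ : 0 < δ) (j : Fin n) : ContDiff ℝ 1 (WY n δ j) := by
  have := contDiff_zSq n
  exact ContDiff.div (by fun_prop) (contDiff_Nd n δ) fun p => (Nd_pos n δ hδ p).ne'

lemma hasDerivAt_aff (a b : ℝ) : HasDerivAt (fun s : ℝ => a + s * b) b 0 := by
  simpa using ((hasDerivAt_id (0:ℝ)).mul_const b).const_add a

lemma line_zSq (n : ℕ) (p v : Hspace n) :
    HasDerivAt (fun s : ℝ => zSq n (p + s • v))
      (∑ i, (2 * p.1 i * v.1 i + 2 * p.2.1 i * v.2.1 i)) 0 := by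
  unfold zSq
  apply HasDerivAt.fun_sum
  intro i _
  have h1 := (hasDerivAt_aff (p.1 i) (v.1 i)).fun_pow 2
  have h2 := (hasDerivAt_aff (p.2.1 i) (v.2.1 i)).fun_pow 2
  simpa using h1.fun_add h2

lemma line_Nd (n : ℕ) (δ : ℝ) (p v : Hspace n) (z : ℝ)
    (hz : HasDerivAt (fun s : ℝ => zSq n (p + s • v)) z 0) :
    HasDerivAt (fun s : ℝ => Nd n δ (p + s • v)) (2 * zSq n p * z + 2 * p.2.2 * v.2.2) 0 := by
  unfold Nd
  have h2 := (hasDerivAt_aff (p.2.2) (v.2.2)).fun_pow 2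
  simpa using ((hz.fun_pow 2).fun_add h2).add_const δ

lemma Xd_WX (n : ℕ) (δ : ℝ) (hδ : 0 < δ) (j : Fin n) (p : Hspace n) :
    Xd n j (WX n δ j) p = (2 * (p.1 j ^ 2 + p.2.1 j ^ 2) + zSq n p) / Nd n δ p
      - 4 * (WX n δ j p) ^ 2 := by
  rw [Xd_eq, ← DifferentiableAt.lineDeriv_eq_fderiv
    ((contDiff_WX n δ hδ j).differentiable (by norm_num) p)]
  have hN := (Nd_pos n δ hδ p).ne'
  have hz := line_zSq n p (Pi.single j 1, 0, 2 * p.2.1 j)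
  have e : (∑ i, (2 * p.1 i * (Pi.single j 1 : Fin n → ℝ) i + 2 * p.2.1 i * (0 : Fin n → ℝ) i))
      = 2 * p.1 j := by
    simp [Pi.single_apply]
  rw [e] at hz
  have hNd := line_Nd n δ p _ _ hz
  have hx := hasDerivAt_aff (p.1 j) 1
  have hy := hasDerivAt_aff (p.2.1 j) 0
  have ht := hasDerivAt_aff (p.2.2) (2 * p.2.1 j)
  have h := ((hz.mul hx).add (hy.mul ht)).div hNd (by simpa using hN)
  have h' : HasDerivAt (fun s : ℝ => WX n δ j (p + s • (Pi.single j 1, 0, 2 * p.2.1 j))) _ 0 :=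
    h.congr_of_eventuallyEq (Filter.Eventually.of_forall fun s => by simp [WX])
  rw [lineDeriv, h'.deriv]
  have hp0 : p + ((0, 0, 0) : Hspace n) = p := add_zero p
  simp [WX, hp0]
  field_simp
  ring

lemma Yd_WY (n : ℕ) (δ : ℝ) (hδ : 0 < δ) (j : Fin n) (p : Hspace n) :
    Yd n j (WY n δ j) p = (2 * (p.1 j ^ 2 + p.2.1 j ^ 2) + zSq n p) / Nd n δ p
      - 4 * (WY n δ j p) ^ 2 := by
  rw [Yd_eq, ← DifferentiableAt.lineDeriv_eq_fderiv
    ((contDiff_WY n δ hδ j).differentiable (by norm_num) p)]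
  have hN := (Nd_pos n δ hδ p).ne'
  have hz := line_zSq n p (0, Pi.single j 1, -2 * p.1 j)
  have e : (∑ i, (2 * p.1 i * (0 : Fin n → ℝ) i + 2 * p.2.1 i * (Pi.single j 1 : Fin n → ℝ) i))
      = 2 * p.2.1 j := by
    simp [Pi.single_apply]
  rw [e] at hz
  have hNd := line_Nd n δ p _ _ hz
  have hx := hasDerivAt_aff (p.1 j) 0
  have hy := hasDerivAt_aff (p.2.1 j) 1
  have ht := hasDerivAt_aff (p.2.2) (-2 * p.1 j)
  have h := ((hz.mul hy).sub (hx.mul ht)).div hNd (by simpa using hN)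
  have h' : HasDerivAt (fun s : ℝ => WY n δ j (p + s • (0, Pi.single j 1, -2 * p.1 j))) _ 0 :=
    h.congr_of_eventuallyEq (Filter.Eventually.of_forall fun s => by simp [WY])
  rw [lineDeriv, h'.deriv]
  have hp0 : p + ((0, 0, 0) : Hspace n) = p := add_zero p
  simp [WY, hp0]
  field_simp
  ring

lemma Xd_sq_mul (n : ℕ) (j : Fin n) (φ W : Hspace n → ℝ) (hφ : ContDiff ℝ 1 φ)
    (hW : ContDiff ℝ 1 W) (p : Hspace n) :
    Xd n j (fun p => φ p ^ 2 * W p) p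
      = 2 * φ p * W p * Xd n j φ p + φ p ^ 2 * Xd n j W p := by
  have h := ((hφ.differentiable (by norm_num) p).hasFDerivAt.pow 2).mul
    (hW.differentiable (by norm_num) p).hasFDerivAt
  have h2 : fderiv ℝ (fun p => φ p ^ 2 * W p) p = _ := h.fderiv
  simp only [Xd_eq, h2]
  simp
  ring

lemma Yd_sq_mul (n : ℕ) (j : Fin n) (φ W : Hspace n → ℝ) (hφ : ContDiff ℝ 1 φ)
    (hW : ContDiff ℝ 1 W) (p : Hspace n) :
    Yd n j (fun p => φ p ^ 2 * W p) p
      = 2 * φ p * W p * Yd n j φ p + φ p ^ 2 * Yd n j W p := by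
  have h := ((hφ.differentiable (by norm_num) p).hasFDerivAt.pow 2).mul
    (hW.differentiable (by norm_num) p).hasFDerivAt
  have h2 : fderiv ℝ (fun p => φ p ^ 2 * W p) p = _ := h.fderiv
  simp only [Yd_eq, h2]
  simp
  ring

lemma hardy_pt (n : ℕ) (hn : 1 ≤ n) (δ : ℝ) (hδ : 0 < δ) (φ : Hspace n → ℝ) (hφ : ContDiff ℝ 1 φ)
    (p : Hspace n) :
    φ p ^ 2 * (zSq n p / Nd n δ p) ≤ gradH2 n φ p +
      ∑ j, (Xd n j (fun p => φ p ^ 2 * WX n δ j p) p + Yd n j (fun p => φ p ^ 2 * WY n δ j p) p) := by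
  have hN := Nd_pos n δ hδ p
  have hz := zSq_nonneg n p
  have hW : ∑ j, (WX n δ j p ^ 2 + WY n δ j p ^ 2) ≤ zSq n p / Nd n δ p := by
    have : ∑ j, (WX n δ j p ^ 2 + WY n δ j p ^ 2)
        = (zSq n p ^ 2 + p.2.2 ^ 2) / Nd n δ p ^ 2 * zSq n p := by
      conv_rhs => rw [show zSq n p = ∑ j : Fin n, ((p.1 j) ^ 2 + (p.2.1 j) ^ 2) from rfl]
      rw [Finset.mul_sum]
      refine Finset.sum_congr rfl fun j _ => ?_
      rw [show ∑ j : Fin n, ((p.1 j) ^ 2 + (p.2.1 j) ^ 2) = zSq n p from rfl]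
      unfold WX WY
      field_simp
      ring
    rw [this, div_mul_eq_mul_div, div_le_div_iff₀ (by positivity) hN]
    have : zSq n p ^ 2 + p.2.2 ^ 2 ≤ Nd n δ p := by unfold Nd; linarith
    nlinarith [mul_le_mul_of_nonneg_right this (mul_nonneg hz hN.le)]
  have hdiv : ∑ j, (Xd n j (WX n δ j) p + Yd n j (WY n δ j) p)
      = (2 * n + 4) * (zSq n p / Nd n δ p) - 4 * ∑ j, (WX n δ j p ^ 2 + WY n δ j p ^ 2) := by
    have : ∀ j, Xd n j (WX n δ j) p + Yd n j (WY n δ j) p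
        = (4 / Nd n δ p) * (p.1 j ^ 2 + p.2.1 j ^ 2) + 2 * (zSq n p / Nd n δ p)
          - 4 * (WX n δ j p ^ 2 + WY n δ j p ^ 2) := by
      intro j; rw [Xd_WX n δ hδ, Yd_WY n δ hδ]; ring
    simp_rw [this]
    have hS4 : ∑ j, 4 * (WX n δ j p ^ 2 + WY n δ j p ^ 2)
        = 4 * ∑ j, (WX n δ j p ^ 2 + WY n δ j p ^ 2) := (Finset.mul_sum ..).symm
    have hS5 : ∑ j, (4 / Nd n δ p) * (p.1 j ^ 2 + p.2.1 j ^ 2) = (4 / Nd n δ p) * zSq n p :=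
      (Finset.mul_sum ..).symm
    rw [Finset.sum_sub_distrib, Finset.sum_add_distrib, hS4, hS5, Finset.sum_const,
      Finset.card_univ, Fintype.card_fin, nsmul_eq_mul]
    ring
  have hsq : 0 ≤ gradH2 n φ p + ∑ j, (2 * φ p * WX n δ j p * Xd n j φ p
      + 2 * φ p * WY n δ j p * Yd n j φ p) + φ p ^ 2 * ∑ j, (WX n δ j p ^ 2 + WY n δ j p ^ 2) := by
    unfold gradH2
    rw [Finset.mul_sum, ← Finset.sum_add_distrib, ← Finset.sum_add_distrib]
    refine Finset.sum_nonneg fun j _ => ?_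
    nlinarith [sq_nonneg (Xd n j φ p + φ p * WX n δ j p), sq_nonneg (Yd n j φ p + φ p * WY n δ j p)]
  have hexp : ∑ j, (Xd n j (fun p => φ p ^ 2 * WX n δ j p) p
        + Yd n j (fun p => φ p ^ 2 * WY n δ j p) p)
      = ∑ j, (2 * φ p * WX n δ j p * Xd n j φ p + 2 * φ p * WY n δ j p * Yd n j φ p)
        + φ p ^ 2 * ∑ j, (Xd n j (WX n δ j) p + Yd n j (WY n δ j) p) := by
    rw [Finset.mul_sum, ← Finset.sum_add_distrib]
    refine Finset.sum_congr rfl fun j _ => ?_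
    rw [Xd_sq_mul n j φ _ hφ (contDiff_WX n δ hδ j), Yd_sq_mul n j φ _ hφ (contDiff_WY n δ hδ j)]
    ring
  rw [hexp, hdiv]
  set M := zSq n p / Nd n δ p
  set V := ∑ j, (WX n δ j p ^ 2 + WY n δ j p ^ 2)
  have hM : 0 ≤ M := by positivity
  have hn1 : (1:ℝ) ≤ n := by exact_mod_cast hn
  have : M ≤ (2 * n + 4) * M - 5 * V := by nlinarith
  nlinarith [mul_le_mul_of_nonneg_left this (sq_nonneg (φ p))]

lemma hardy_delta (n : ℕ) (hn : 1 ≤ n) (δ : ℝ) (hδ : 0 < δ) (φ : Hspace n → ℝ)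
    (hφ : ContDiff ℝ 1 φ) (hs : HasCompactSupport φ) :
    ∫⁻ p, ENNReal.ofReal (φ p ^ 2 * (zSq n p / Nd n δ p)) ≤ energy n φ := by
  have hsq : HasCompactSupport (fun p => φ p ^ 2) :=
    hs.comp_left (g := fun x : ℝ => x ^ 2) (by simp)
  have hX := fun j => int_Xd_zero n j (fun p => φ p ^ 2 * WX n δ j p)
    ((hφ.pow 2).mul (contDiff_WX n δ hδ j)) hsq.mul_right
  have hY := fun j => int_Yd_zero n j (fun p => φ p ^ 2 * WY n δ j p)
    ((hφ.pow 2).mul (contDiff_WY n δ hδ j)) hsq.mul_right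
  have hgc : HasCompactSupport (gradH2 n φ) := by
    have h1 : HasCompactSupport (fderiv ℝ φ) := hs.fderiv (𝕜 := ℝ)
    refine h1.mono ?_
    intro p hp hp0
    apply hp
    simp [gradH2, Xd, Yd, hp0]
  have hgi : Integrable (gradH2 n φ) :=
    (continuous_gradH2 n φ hφ).integrable_of_hasCompactSupport hgc
  have hdi : Integrable (fun p => ∑ j, (Xd n j (fun p => φ p ^ 2 * WX n δ j p) p
      + Yd n j (fun p => φ p ^ 2 * WY n δ j p) p)) :=
    integrable_finsetSum _ fun j _ => (hX j).2.add (hY j).2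
  have hd0 : ∫ p, ∑ j, (Xd n j (fun p => φ p ^ 2 * WX n δ j p) p
      + Yd n j (fun p => φ p ^ 2 * WY n δ j p) p) = 0 := by
    rw [integral_finsetSum (f := fun j p => Xd n j (fun p => φ p ^ 2 * WX n δ j p) p
      + Yd n j (fun p => φ p ^ 2 * WY n δ j p) p) _ fun j _ => (hX j).2.add (hY j).2]
    refine Finset.sum_eq_zero fun j _ => ?_
    have := integral_add (hX j).2 (hY j).2
    rw [this, (hX j).1, (hY j).1, add_zero]
  have hnn : ∀ p, 0 ≤ φ p ^ 2 * (zSq n p / Nd n δ p) := fun p =>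
    mul_nonneg (sq_nonneg _) (div_nonneg (zSq_nonneg n p) (Nd_pos n δ hδ p).le)
  have hli : Integrable (fun p => φ p ^ 2 * (zSq n p / Nd n δ p)) := by
    have h1 : Continuous (fun p => zSq n p / Nd n δ p) :=
      (contDiff_zSq n).continuous.div (contDiff_Nd n δ).continuous fun p => (Nd_pos n δ hδ p).ne'
    exact ((hφ.continuous.pow 2).mul h1).integrable_of_hasCompactSupport hsq.mul_right
  unfold energy
  rw [← ofReal_integral_eq_lintegral_ofReal hli (Filter.Eventually.of_forall hnn),
    ← ofReal_integral_eq_lintegral_ofReal hgi (Filter.Eventually.of_forall (gradH2_nonneg n φ))]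
  apply ENNReal.ofReal_le_ofReal
  have := integral_mono hli (hgi.add hdi) (hardy_pt n hn δ hδ φ hφ)
  rw [integral_add' hgi hdi, hd0, add_zero] at this
  exact this

lemma rho_four (n : ℕ) (p : Hspace n) : rho n p ^ 4 = zSq n p ^ 2 + p.2.2 ^ 2 := by
  unfold rho
  rw [← Real.rpow_natCast, ← Real.rpow_mul (by positivity)]
  norm_num

lemma weight_sq (n : ℕ) (p : Hspace n) :
    (√(zSq n p) / rho n p ^ 2) ^ 2 = zSq n p / (zSq n p ^ 2 + p.2.2 ^ 2) := by
  rw [div_pow, Real.sq_sqrt (zSq_nonneg n p), ← rho_four]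
  ring

lemma eq_zero_of_N (n : ℕ) (p : Hspace n) (h : zSq n p ^ 2 + p.2.2 ^ 2 ≤ 0) : p = 0 := by
  have h1 : p.2.2 = 0 := by nlinarith [sq_nonneg (zSq n p), sq_nonneg p.2.2]
  have h2 : zSq n p = 0 := by nlinarith [sq_nonneg (zSq n p), sq_nonneg p.2.2]
  unfold zSq at h2
  rw [Finset.sum_eq_zero_iff_of_nonneg fun _ _ => by positivity] at h2
  refine Prod.ext ?_ (Prod.ext ?_ h1)
  · ext i; have := h2 i (Finset.mem_univ _)
    simp; nlinarith [sq_nonneg (p.1 i), sq_nonneg (p.2.1 i)]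
  · ext i; have := h2 i (Finset.mem_univ _)
    simp; nlinarith [sq_nonneg (p.1 i), sq_nonneg (p.2.1 i)]

theorem hardyH (n : ℕ) (hn : 1 ≤ n) (φ : Hspace n → ℝ)
    (hφ : ContDiff ℝ 1 φ) (hs : HasCompactSupport φ) (h0 : (0 : Hspace n) ∉ tsupport φ) :
    ∫⁻ p, ENNReal.ofReal ((√(zSq n p) / rho n p ^ 2) ^ 2 * φ p ^ 2) ≤ 2 * energy n φ := by
  have hNc : Continuous (fun p : Hspace n => zSq n p ^ 2 + p.2.2 ^ 2) := by
    have := (contDiff_zSq n).continuous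
    fun_prop
  have : ∃ δ : ℝ, 0 < δ ∧ ∀ p ∈ tsupport φ, δ ≤ zSq n p ^ 2 + p.2.2 ^ 2 := by
    rcases (tsupport φ).eq_empty_or_nonempty with he | hne
    · exact ⟨1, one_pos, by simp [he]⟩
    · obtain ⟨p0, hp0, hmin⟩ := IsCompact.exists_isMinOn hs hne hNc.continuousOn
      refine ⟨_, ?_, fun p hp => hmin hp⟩
      by_contra hneg
      exact h0 (eq_zero_of_N n p0 (not_lt.1 hneg) ▸ hp0)
  obtain ⟨δ, hδ, hb⟩ := this
  calc _ ≤ ∫⁻ p, 2 * ENNReal.ofReal (φ p ^ 2 * (zSq n p / Nd n δ p)) := by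
        refine lintegral_mono fun p => ?_
        rw [show (2 : ENNReal) = ENNReal.ofReal 2 by simp, ← ENNReal.ofReal_mul (by norm_num)]
        apply ENNReal.ofReal_le_ofReal
        rw [weight_sq]
        by_cases hp : p ∈ tsupport φ
        · have hN := hb p hp
          have hz := zSq_nonneg n p
          have : zSq n p / (zSq n p ^ 2 + p.2.2 ^ 2) ≤ 2 * (zSq n p / Nd n δ p) := by
            rw [← mul_div_assoc, div_le_div_iff₀ (by linarith) (Nd_pos n δ hδ p)]
            unfold Nd
            nlinarith
          nlinarith [mul_le_mul_of_nonneg_right this (sq_nonneg (φ p))]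
        · rw [image_eq_zero_of_notMem_tsupport hp]; simp
    _ = 2 * ∫⁻ p, ENNReal.ofReal (φ p ^ 2 * (zSq n p / Nd n δ p)) :=
        lintegral_const_mul' _ _ (by simp)
    _ ≤ _ := by gcongr; exact hardy_delta n hn δ hδ φ hφ hs

lemma measurable_zSq_ckn (n : ℕ) : Measurable (zSq n) := by
  unfold zSq; fun_prop

lemma measurable_rho_ckn (n : ℕ) : Measurable (rho n) := by
  have := measurable_zSq_ckn n
  unfold rho
  fun_prop

/-- Pointwise interpolation identity. -/
lemma ckn_pointwise (m s w a : ℝ) (hm : 0 < m) (hs0 : 0 ≤ s) (hs2 : s ≤ 2) (hw : 0 ≤ w)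
    (ha : 0 ≤ a) :
    w ^ s * a ^ (2 * (m + 2 - s) / m) =
      (w ^ 2 * a ^ 2) ^ (s / 2) * (a ^ (2 * (m + 2) / m)) ^ (1 - s / 2) := by
  have h1 : (w ^ 2 * a ^ 2) ^ (s / 2) = w ^ s * a ^ s := by
    rw [Real.mul_rpow (by positivity) (by positivity), ← Real.rpow_natCast_mul hw,
      ← Real.rpow_natCast_mul ha]
    congr 2 <;> push_cast <;> ring
  have hq : 0 ≤ 2 * (m + 2) / m * (1 - s / 2) := by
    have : 0 ≤ 1 - s / 2 := by linarith
    positivity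
  rw [h1, ← Real.rpow_mul ha, mul_assoc, ← Real.rpow_add_of_nonneg ha hs0 hq]
  congr 2
  field_simp
  ring

/-- Caffarelli–Kohn–Nirenberg type inequality on ℍⁿ:
for `0 ≤ s ≤ 2` there exists `C > 0` with
`∫ |∇_ℍ φ|² ≥ C (∫ (|z|/ρ²)^s |φ|^{2(Q−s)/(Q−2)})^{(Q−2)/(Q−s)}`. -/
theorem heisenberg_CKN (n : ℕ) (hn : 1 ≤ n) (Q s : ℝ) (hQ : Q = 2 * n + 2)
    (hs0 : 0 ≤ s) (hs2 : s ≤ 2) :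
    ∃ C : ℝ, 0 < C ∧ ∀ φ : Hspace n → ℝ, ContDiff ℝ (⊤ : ℕ∞) φ → HasCompactSupport φ →
      (0 : Hspace n) ∉ tsupport φ →
      (∫⁻ p, ENNReal.ofReal (gradH2 n φ p)) ≥
        ENNReal.ofReal C *
          (∫⁻ p, ENNReal.ofReal ((Real.sqrt (zSq n p) / rho n p ^ 2) ^ s *
              |φ p| ^ (2 * (Q - s) / (Q - 2)))) ^ ((Q - 2) / (Q - s)) := by
  obtain ⟨K, hK, hSob⟩ := sobolevH n hn
  have hn1 : (1 : ℝ) ≤ n := by exact_mod_cast hn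
  set M : ℝ := max 2 K with hM
  have hM0 : 0 < M := lt_of_lt_of_le (by norm_num) (le_max_left 2 K)
  refine ⟨M⁻¹, inv_pos.mpr hM0, fun φ hφ hc h0 => ?_⟩
  have hφ1 : ContDiff ℝ 1 φ := hφ.of_le (by exact_mod_cast le_top)
  have hA := hardyH n hn φ hφ1 hc h0
  have hB := hSob φ hφ1 hc
  have hm : (0 : ℝ) < 2 * n := by linarith
  have hθ : 0 ≤ 1 - s / 2 := by linarith
  change ENNReal.ofReal M⁻¹ * _ ≤ energy n φ
  set E := energy n φ with hE
  set A := ∫⁻ p, ENNReal.ofReal ((√(zSq n p) / rho n p ^ 2) ^ 2 * φ p ^ 2) with hAdef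
  set B := ∫⁻ p, ENNReal.ofReal (|φ p| ^ (2 * (2 * n + 2) / (2 * n : ℝ))) with hBdef
  set T := ENNReal.ofReal M * E with hT
  have hA' : A ≤ T := by
    refine hA.trans ?_
    rw [hT]
    gcongr
    rw [show (2 : ENNReal) = ENNReal.ofReal 2 by simp]
    exact ENNReal.ofReal_le_ofReal (le_max_left 2 K)
  have hB' : B ≤ T ^ ((2 * n + 2) / (2 * n) : ℝ) := by
    have h1 : B ^ ((2 * n) / (2 * n + 2) : ℝ) ≤ T := by
      refine hB.trans ?_
      rw [hT]
      gcongr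
      exact le_max_right 2 K
    have h2 := ENNReal.rpow_le_rpow h1 (z := ((2 * n + 2) / (2 * n) : ℝ)) (by positivity)
    rwa [← ENNReal.rpow_mul,
      show ((2 * n) / (2 * n + 2) : ℝ) * ((2 * n + 2) / (2 * n)) = 1 by field_simp,
      ENNReal.rpow_one] at h2
  have hmz := measurable_zSq_ckn n
  have hmr := measurable_rho_ckn n
  have hmφ : Measurable φ := hφ.continuous.measurable
  have hI : (∫⁻ p, ENNReal.ofReal ((Real.sqrt (zSq n p) / rho n p ^ 2) ^ s *
      |φ p| ^ (2 * (Q - s) / (Q - 2)))) ≤ A ^ (s / 2) * B ^ (1 - s / 2) := by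
    refine le_trans (le_of_eq ?_) (ENNReal.lintegral_mul_norm_pow_le (μ := volume)
      (f := fun p => ENNReal.ofReal ((√(zSq n p) / rho n p ^ 2) ^ 2 * φ p ^ 2))
      (g := fun p => ENNReal.ofReal (|φ p| ^ (2 * (2 * n + 2) / (2 * n : ℝ))))
      (by fun_prop) (by fun_prop) (p := s / 2) (q := 1 - s / 2) (by linarith) hθ (by ring))
    refine lintegral_congr fun p => ?_
    have hw : 0 ≤ √(zSq n p) / rho n p ^ 2 := by positivity
    rw [ENNReal.ofReal_rpow_of_nonneg (by positivity) (by linarith),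
      ENNReal.ofReal_rpow_of_nonneg (by positivity) hθ,
      ← ENNReal.ofReal_mul (by positivity)]
    have h := ckn_pointwise (2 * n) s _ _ hm hs0 hs2 hw (abs_nonneg (φ p))
    rw [sq_abs] at h
    rw [← h, hQ]
    congr 3
    ring_nf
  have hQs : 0 < Q - s := by linarith
  have hI2 : (∫⁻ p, ENNReal.ofReal ((Real.sqrt (zSq n p) / rho n p ^ 2) ^ s *
      |φ p| ^ (2 * (Q - s) / (Q - 2)))) ≤ T ^ ((Q - s) / (Q - 2)) := by
    refine hI.trans ?_
    calc A ^ (s / 2) * B ^ (1 - s / 2)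
        ≤ T ^ (s / 2) * (T ^ ((2 * n + 2) / (2 * n) : ℝ)) ^ (1 - s / 2) := by gcongr
      _ = T ^ ((Q - s) / (Q - 2)) := by
        rw [← ENNReal.rpow_mul, ← ENNReal.rpow_add_of_nonneg _ _ (by linarith) (by positivity)]
        congr 1
        rw [hQ]
        have : (2 * (n : ℝ) + 2 - 2) = 2 * n := by ring
        rw [this]
        field_simp
        ring
  have hQ2 : 0 < Q - 2 := by linarith
  have hI3 := ENNReal.rpow_le_rpow hI2 (z := (Q - 2) / (Q - s)) (by positivity)
  rw [← ENNReal.rpow_mul, show (Q - s) / (Q - 2) * ((Q - 2) / (Q - s)) = 1 by field_simp,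
    ENNReal.rpow_one] at hI3
  calc _ ≤ ENNReal.ofReal M⁻¹ * T := by gcongr
    _ = E := by
      rw [hT, ← mul_assoc, ← ENNReal.ofReal_mul (by positivity), inv_mul_cancel₀ hM0.ne']
      simp
end
end
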